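/- arXiv:2406.02003 — 8 statements merged into one kernel-verified Lean document; each statement's English description precedes it below -/
import Mathlib

section
/- Let K ⊆ ℝ^d be a compact set and φ : K → ℝ a continuous function with a unique global minimizer x⋆ lying in the interior of K. Assume φ is twice continuously differentiable on a neighborhood of x⋆ with strictly positive definite Hessian ∇²φ(x⋆). Then for any continuous function h : K → ℝ, the quantity √(det ∇²φ(x⋆)) · (exp(φ(x⋆)/δ)/(2πδ)^{d/2}) · ∫_K h(x) exp(−φ(x)/δ) dx converges to h(x⋆) as δ → 0⁺. -/
open MeasureTheory Real Filter Set Topology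

/-- Second-order Taylor expansion, with Peano remainder, at a critical point. -/
theorem ContDiffAt.isLittleO_sub_half_snd_fderiv {E : Type*} [NormedAddCommGroup E]
    [NormedSpace ℝ E] {f : E → ℝ} {a : E} (hf : ContDiffAt ℝ 2 f a) (ha : fderiv ℝ f a = 0) :
    (fun x => f x - f a - 1 / 2 * fderiv ℝ (fderiv ℝ f) a (x - a) (x - a))
      =o[𝓝 a] fun x => ‖x - a‖ ^ 2 := by
  have hsymm : IsSymmSndFDerivAt ℝ f a := hf.isSymmSndFDerivAt (by simp)
  set B := fderiv ℝ (fderiv ℝ f) a with hB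
  have hB' : HasFDerivAt (fderiv ℝ f) B a :=
    ((hf.fderiv_right (m := 1) (by norm_num)).differentiableAt (by norm_num)).hasFDerivAt
  have hdiff : ∀ᶠ x in 𝓝 a, DifferentiableAt ℝ f x :=
    (hf.eventually (by simp)).mono fun x hx => hx.differentiableAt (by norm_num)
  rw [Asymptotics.isLittleO_iff]
  intro c hc
  have hsmall := (Asymptotics.isLittleO_iff.1 hB'.isLittleO) hc
  obtain ⟨r, hr, hball⟩ := Metric.eventually_nhds_iff_ball.1 (hdiff.and hsmall)
  filter_upwards [Metric.ball_mem_nhds a hr] with x hx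
  have hderiv : ∀ y ∈ segment ℝ a x, HasFDerivWithinAt
      (fun y => f y - 1 / 2 * B (y - a) (y - a)) (fderiv ℝ f y - B (y - a)) (segment ℝ a x) y := by
    intro y hy
    have hy' := (convex_ball a r).segment_subset (Metric.mem_ball_self hr) hx hy
    have h1 : HasFDerivAt (fun y : E => y - a) (ContinuousLinearMap.id ℝ E) y :=
      (hasFDerivAt_id y).sub_const a
    have h2 := ((B.hasFDerivAt.comp y h1).clm_apply h1).const_mul (1 / 2 : ℝ)
    refine ((hball y hy').1.hasFDerivAt.sub h2).hasFDerivWithinAt.congr_fderiv ?_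
    ext v
    have := hsymm v (y - a)
    simp [← hB] at this ⊢
    rw [this]; ring
  have hbound : ∀ y ∈ segment ℝ a x, ‖fderiv ℝ f y - B (y - a)‖ ≤ c * ‖x - a‖ := by
    intro y hy
    have hy' := (convex_ball a r).segment_subset (Metric.mem_ball_self hr) hx hy
    have := (hball y hy').2
    rw [ha, sub_zero] at this
    refine this.trans (mul_le_mul_of_nonneg_left ?_ hc.le)
    have := (convex_closedBall a ‖x - a‖).segment_subset
      (Metric.mem_closedBall_self (norm_nonneg _)) (by simp [dist_eq_norm]) hy
    simpa [dist_eq_norm] using this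
  have := (convex_segment a x).norm_image_sub_le_of_norm_hasFDerivWithin_le hderiv hbound
    (left_mem_segment ℝ a x) (right_mem_segment ℝ a x)
  simp only [sub_self, map_zero, mul_zero, sub_zero] at this
  rw [norm_pow, norm_norm]
  calc _ = ‖f x - 1 / 2 * B (x - a) (x - a) - f a‖ := by congr 1; ring
    _ ≤ _ := this
    _ = _ := by ring

/-- A positive definite bilinear form on a finite-dimensional space is coercive. -/
theorem ContinuousLinearMap.exists_pos_mul_sq_norm_le {E : Type*} [NormedAddCommGroup E]
    [NormedSpace ℝ E] [FiniteDimensional ℝ E] (B : E →L[ℝ] E →L[ℝ] ℝ)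
    (hB : ∀ v, v ≠ 0 → 0 < B v v) : ∃ c > 0, ∀ v, c * ‖v‖ ^ 2 ≤ B v v := by
  have hcompact : IsCompact (Metric.sphere (0 : E) 1) := isCompact_sphere 0 1
  obtain ⟨c, hc, hcB⟩ : ∃ c > 0, ∀ v ∈ Metric.sphere (0 : E) 1, c ≤ B v v :=
    hcompact.exists_forall_le' (by fun_prop) fun v hv => hB v (by
      rintro rfl; simp at hv)
  refine ⟨c, hc, fun v => ?_⟩
  rcases eq_or_ne v 0 with rfl | hv
  · simp
  have hv' : 0 < ‖v‖ := norm_pos_iff.2 hv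
  have := hcB (‖v‖⁻¹ • v) (by simp [norm_smul, hv'.ne'])
  simp only [map_smul, smul_apply, smul_eq_mul] at this
  calc c * ‖v‖ ^ 2 ≤ (‖v‖⁻¹ * (‖v‖⁻¹ * B v v)) * ‖v‖ ^ 2 := by gcongr
    _ = B v v := by field_simp

/-- The Gaussian integral of a positive definite symmetric bilinear form. -/
theorem sqrt_det_mul_integral_exp_neg_half {d : ℕ}
    (B : EuclideanSpace ℝ (Fin d) →L[ℝ] EuclideanSpace ℝ (Fin d) →L[ℝ] ℝ)
    (hsymm : ∀ v w, B v w = B w v) (hB : ∀ v, v ≠ 0 → 0 < B v v) :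
    √(Matrix.det (Matrix.of fun i j : Fin d =>
      B (EuclideanSpace.single i 1) (EuclideanSpace.single j 1))) *
      ∫ v, Real.exp (-(1 / 2 * B v v)) = (2 * π) ^ ((d : ℝ) / 2) := by
  set M : Matrix (Fin d) (Fin d) ℝ := Matrix.of fun i j =>
      B (EuclideanSpace.single i 1) (EuclideanSpace.single j 1) with hM
  have hquad : ∀ v : EuclideanSpace ℝ (Fin d), B v v = v.ofLp ⬝ᵥ M.mulVec v.ofLp := by
    intro v
    have hv : v = ∑ i, v i • EuclideanSpace.single i (1 : ℝ) := by
      ext j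
      simp [Finset.sum_apply, Pi.single_apply]
    conv_lhs => rw [hv]
    simp [dotProduct, Matrix.mulVec, hM, Finset.mul_sum]
    refine Finset.sum_congr rfl fun i _ => Finset.sum_congr rfl fun j _ => ?_
    rw [hsymm]
    ring
  have hpos : M.PosDef := by
    refine Matrix.posDef_iff_dotProduct_mulVec.2 ⟨?_, fun x hx => ?_⟩
    · ext i j
      simp [hM, hsymm]
    · have := hB (WithLp.toLp 2 x) (by simpa using hx)
      rw [hquad] at this
      simpa using this
  obtain ⟨S, hS⟩ : ∃ S : Matrix (Fin d) (Fin d) ℝ, M = S.transpose * S := by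
    open scoped MatrixOrder Matrix.Norms.L2Operator in
    obtain ⟨S, hS⟩ := CStarAlgebra.nonneg_iff_eq_star_mul_self.mp hpos.posSemidef.nonneg
    exact ⟨S, by simpa [Matrix.star_eq_conjTranspose] using hS⟩
  have hdet : M.det = S.det ^ 2 := by rw [hS, Matrix.det_mul, Matrix.det_transpose, sq]
  have hdet0 : S.det ≠ 0 := by
    intro h0
    have := hpos.det_pos
    rw [hdet, h0] at this
    simp at this
  let L := Matrix.toLpLin 2 2 S
  have hLdet : LinearMap.det L = S.det := LinearMap.det_toLpLin 2 S
  have hnorm : ∀ v, B v v = ‖L v‖ ^ 2 := by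
    intro v
    rw [hquad, hS, EuclideanSpace.real_norm_sq_eq, ← Matrix.mulVec_mulVec,
      Matrix.dotProduct_mulVec, Matrix.vecMul_transpose]
    simp [L, dotProduct, sq]
  have hint : ∫ v, Real.exp (-(1 / 2 * B v v)) = |S.det|⁻¹ * (2 * π) ^ ((d : ℝ) / 2) := by
    have hmap := Measure.map_linearMap_addHaar_eq_smul_addHaar
      (volume : Measure (EuclideanSpace ℝ (Fin d))) (f := L) (by rwa [hLdet])
    have hG := GaussianFourier.integral_rexp_neg_mul_sq_norm
      (V := EuclideanSpace ℝ (Fin d)) (b := 1 / 2) (by norm_num)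
    have hcomp := integral_map (μ := (volume : Measure (EuclideanSpace ℝ (Fin d)))) (φ := L)
      L.continuous_of_finiteDimensional.aemeasurable
      (f := fun v => Real.exp (-(1 / 2) * ‖v‖ ^ 2)) (by fun_prop)
    rw [hmap, integral_smul_measure, hG, hLdet] at hcomp
    simp only [hnorm]
    simp only [← neg_mul]
    rw [← hcomp, ENNReal.toReal_ofReal (abs_nonneg _), abs_inv, smul_eq_mul,
      finrank_euclideanSpace_fin]
    congr 2
    ring
  rw [hint, hdet, Real.sqrt_sq_eq_abs, mul_inv_cancel_left₀ (abs_ne_zero.2 hdet0)]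

/-- Global quadratic growth on a compact set from local quadratic growth at a strict minimizer. -/
theorem IsCompact.exists_pos_mul_sq_norm_sub_le {E : Type*} [NormedAddCommGroup E]
    {K : Set E} (hK : IsCompact K) {f : E → ℝ} (hf : ContinuousOn f K) {a : E}
    (hmin : ∀ x ∈ K, x ≠ a → f a < f x) {c : ℝ} (hc : 0 < c)
    (hloc : ∀ᶠ x in 𝓝 a, c * ‖x - a‖ ^ 2 ≤ f x - f a) :
    ∃ c' > 0, ∀ x ∈ K, c' * ‖x - a‖ ^ 2 ≤ f x - f a := by
  obtain ⟨U, hU, hUo, haU⟩ := eventually_nhds_iff.1 hloc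
  have hKU : IsCompact (K \ U) := hK.diff hUo
  obtain ⟨m, hm, hmf⟩ : ∃ m > 0, ∀ x ∈ K \ U, m ≤ f x - f a :=
    hKU.exists_forall_le' ((hf.mono sdiff_subset).sub continuousOn_const) fun x hx =>
      sub_pos.2 (hmin x hx.1 fun h => hx.2 (h ▸ haU))
  obtain ⟨R, hR⟩ := hK.exists_bound_of_continuousOn (f := fun x => ‖x - a‖ ^ 2) (by fun_prop)
  have hR1 : 0 < |R| + 1 := by positivity
  refine ⟨min c (m / (|R| + 1)), lt_min hc (by positivity), fun x hx => ?_⟩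
  by_cases hxU : x ∈ U
  · exact (mul_le_mul_of_nonneg_right (min_le_left _ _) (by positivity)).trans (hU x hxU)
  · have hle : ‖x - a‖ ^ 2 ≤ |R| + 1 := by
      have := hR x hx
      rw [Real.norm_of_nonneg (by positivity)] at this
      linarith [le_abs_self R]
    calc _ ≤ m / (|R| + 1) * (|R| + 1) :=
          mul_le_mul (min_le_right _ _) hle (by positivity) (by positivity)
      _ = m := by field_simp
      _ ≤ _ := hmf x ⟨hx, hxU⟩

/-- Rescaled dominated convergence at the heart of Laplace's method. -/
theorem tendsto_integral_indicator_rescaled {E : Type*} [NormedAddCommGroup E]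
    [InnerProductSpace ℝ E] [FiniteDimensional ℝ E] [MeasurableSpace E] [BorelSpace E]
    {K : Set E} (hK : IsCompact K) {f h : E → ℝ} (hf : ContinuousOn f K)
    (hh : ContinuousOn h K) {a : E} (ha : K ∈ 𝓝 a) {B : E →L[ℝ] E →L[ℝ] ℝ}
    (hB : (fun x => f x - f a - 1 / 2 * B (x - a) (x - a)) =o[𝓝 a] fun x => ‖x - a‖ ^ 2)
    {c : ℝ} (hc : 0 < c) (hgrowth : ∀ x ∈ K, c * ‖x - a‖ ^ 2 ≤ f x - f a) :
    Tendsto (fun δ : ℝ => ∫ v, K.indicator (fun x => h x * Real.exp (-(f x - f a) / δ))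
      (a + √δ • v)) (𝓝[>] 0) (𝓝 (∫ v, h a * Real.exp (-(1 / 2 * B v v)))) := by
  obtain ⟨H, hH⟩ := hK.exists_bound_of_continuousOn hh
  have hH0 : 0 ≤ H := (norm_nonneg _).trans (hH a (mem_of_mem_nhds ha))
  have hgauss : Integrable fun v : E => Real.exp (-c * ‖v‖ ^ 2) := by
    by_contra hcon
    have := GaussianFourier.integral_rexp_neg_mul_sq_norm (V := E) hc
    rw [integral_undef hcon] at this
    have : 0 < (π / c) ^ (Module.finrank ℝ E / 2 : ℝ) := by positivity
    linarith
  refine tendsto_integral_filter_of_dominated_convergence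
    (fun v => H * Real.exp (-c * ‖v‖ ^ 2)) ?_ ?_ (hgauss.const_mul H) ?_
  · refine Eventually.of_forall fun δ => ?_
    have hmeas : Measurable (K.indicator fun x => h x * Real.exp (-(f x - f a) / δ)) := by
      classical
      rw [← piecewise_eq_indicator]
      refine ContinuousOn.measurable_piecewise ?_ continuousOn_const hK.measurableSet
      fun_prop
    exact (hmeas.comp (by fun_prop)).aestronglyMeasurable
  · filter_upwards [self_mem_nhdsWithin] with δ (hδ : 0 < δ)
    refine Eventually.of_forall fun v => ?_
    by_cases hv : a + √δ • v ∈ K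
    · rw [indicator_of_mem hv, norm_mul, Real.norm_of_nonneg (Real.exp_nonneg _)]
      refine mul_le_mul (hH _ hv) (Real.exp_le_exp.2 ?_) (Real.exp_nonneg _) hH0
      have := hgrowth _ hv
      rw [add_sub_cancel_left, norm_smul, mul_pow, Real.norm_of_nonneg (Real.sqrt_nonneg _),
        Real.sq_sqrt hδ.le] at this
      rw [div_le_iff₀ hδ]
      linarith
    · rw [indicator_of_notMem hv, norm_zero]
      positivity
  · refine Eventually.of_forall fun v => ?_
    have hpath : Tendsto (fun δ : ℝ => a + √δ • v) (𝓝[>] 0) (𝓝 a) := by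
      have : Continuous fun δ : ℝ => a + √δ • v := by fun_prop
      simpa using (this.tendsto 0).mono_left nhdsWithin_le_nhds
    have hquot : Tendsto (fun δ : ℝ => (f (a + √δ • v) - f a) / δ) (𝓝[>] 0)
        (𝓝 (1 / 2 * B v v)) := by
      have h1 := hB.comp_tendsto hpath
      have h2 : (fun δ : ℝ => f (a + √δ • v) - f a - δ * (1 / 2 * B v v))
          =o[𝓝[>] 0] fun δ : ℝ => δ := by
        refine (h1.trans_isBigO ?_).congr' ?_ EventuallyEq.rfl
        · refine Asymptotics.IsBigO.of_bound (‖v‖ ^ 2) ?_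
          filter_upwards [self_mem_nhdsWithin] with δ (hδ : 0 < δ)
          simp [norm_smul, mul_pow, Real.sq_sqrt hδ.le, abs_of_pos hδ, mul_comm]
        · filter_upwards [self_mem_nhdsWithin] with δ (hδ : 0 < δ)
          have := Real.mul_self_sqrt hδ.le
          simp only [Function.comp_apply, add_sub_cancel_left, map_smul,
            smul_apply, smul_eq_mul]
          rw [← mul_assoc (√δ), this]
          ring
      have h3 := h2.tendsto_div_nhds_zero.add_const (1 / 2 * B v v)
      rw [zero_add] at h3
      refine h3.congr' ?_
      filter_upwards [self_mem_nhdsWithin] with δ (hδ : 0 < δ)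
      field_simp
      ring
    have hexp := ((hh.continuousAt ha).tendsto.comp hpath).mul
      ((Real.continuous_exp.tendsto _).comp hquot.neg)
    refine hexp.congr' ?_
    filter_upwards [hpath.eventually ha] with δ hδ
    rw [indicator_of_mem (show a + √δ • v ∈ K from hδ)]
    simp only [Function.comp_apply, neg_div]

/-- Laplace's method, compact case. -/
theorem laplace_method_compact {d : ℕ}
    (K : Set (EuclideanSpace ℝ (Fin d))) (hK : IsCompact K)
    (φ h : EuclideanSpace ℝ (Fin d) → ℝ)
    (hφ : ContinuousOn φ K)
    (xs : EuclideanSpace ℝ (Fin d))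
    (hxsK : xs ∈ K) (hxsint : xs ∈ interior K)
    (hmin : ∀ x ∈ K, x ≠ xs → φ xs < φ x)
    (hC2 : ∃ U ∈ 𝓝 xs, ContDiffOn ℝ 2 φ U)
    (hposdef : ∀ v : EuclideanSpace ℝ (Fin d), v ≠ 0 →
      0 < fderiv ℝ (fderiv ℝ φ) xs v v)
    (hh : ContinuousOn h K) :
    Tendsto (fun δ : ℝ =>
      Real.sqrt (Matrix.det (Matrix.of fun i j : Fin d =>
          fderiv ℝ (fderiv ℝ φ) xs (EuclideanSpace.single i 1)
            (EuclideanSpace.single j 1))) *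
        (Real.exp (φ xs / δ) / (2 * Real.pi * δ) ^ ((d : ℝ) / 2)) *
        ∫ x in K, h x * Real.exp (-φ x / δ))
      (𝓝[>] 0) (𝓝 (h xs)) := by
  have hKn : K ∈ 𝓝 xs := mem_interior_iff_mem_nhds.1 hxsint
  obtain ⟨U, hU, hUC⟩ := hC2
  have hC : ContDiffAt ℝ 2 φ xs := hUC.contDiffAt hU
  have hlocmin : IsLocalMin φ xs := by
    filter_upwards [hKn] with x hx
    rcases eq_or_ne x xs with rfl | hne
    · exact le_rfl
    · exact (hmin x hx hne).le
  have htaylor := hC.isLittleO_sub_half_snd_fderiv hlocmin.fderiv_eq_zero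
  have hsymm : IsSymmSndFDerivAt ℝ φ xs := hC.isSymmSndFDerivAt (by simp)
  have hgauss := sqrt_det_mul_integral_exp_neg_half _ hsymm hposdef
  obtain ⟨m, hm, hmB⟩ := ContinuousLinearMap.exists_pos_mul_sq_norm_le _ hposdef
  set B := fderiv ℝ (fderiv ℝ φ) xs
  have hloc : ∀ᶠ x in 𝓝 xs, m / 4 * ‖x - xs‖ ^ 2 ≤ φ x - φ xs := by
    filter_upwards [Asymptotics.isLittleO_iff.1 htaylor (show 0 < m / 4 by positivity)] with x hx
    rw [norm_pow, norm_norm, Real.norm_eq_abs] at hx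
    linarith [(abs_le.1 hx).1, hmB (x - xs)]
  obtain ⟨c, hc, hgrowth⟩ := hK.exists_pos_mul_sq_norm_sub_le hφ hmin (by positivity) hloc
  have hlim := (tendsto_integral_indicator_rescaled hK hφ hh hKn htaylor hc hgrowth).const_mul
    (√(Matrix.det (Matrix.of fun i j : Fin d =>
      B (EuclideanSpace.single i 1) (EuclideanSpace.single j 1))) / (2 * π) ^ ((d : ℝ) / 2))
  have hpi : (0 : ℝ) < (2 * π) ^ ((d : ℝ) / 2) := by positivity
  rw [integral_const_mul, div_mul_eq_mul_div, mul_left_comm, hgauss,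
    mul_div_cancel_right₀ _ hpi.ne'] at hlim
  refine hlim.congr' ?_
  filter_upwards [self_mem_nhdsWithin] with δ (hδ : 0 < δ)
  set G := K.indicator fun x => h x * Real.exp (-(φ x - φ xs) / δ) with hG
  have hscale : ∫ v, G (xs + √δ • v) = (δ ^ ((d : ℝ) / 2))⁻¹ * ∫ x, G x := by
    rw [Measure.integral_comp_smul_of_nonneg volume (fun v => G (xs + v)) (√δ)
      (hR := Real.sqrt_nonneg δ), integral_add_left_eq_self, finrank_euclideanSpace_fin,
      smul_eq_mul, Real.sqrt_eq_rpow, ← Real.rpow_natCast, ← Real.rpow_mul hδ.le]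
    congr 3
    ring
  have hGint : ∫ x, G x = Real.exp (φ xs / δ) * ∫ x in K, h x * Real.exp (-φ x / δ) := by
    rw [hG, integral_indicator hK.measurableSet, ← integral_const_mul]
    congr 1 with x
    rw [mul_left_comm, ← Real.exp_add]
    congr 2
    ring
  rw [hscale, hGint, Real.mul_rpow (by positivity) hδ.le]
  have : (0 : ℝ) < δ ^ ((d : ℝ) / 2) := by positivity
  field_simp
end

section
/- Let K ⊆ ℝ^d be a compact set and φ : K → ℝ a continuous function with a unique global minimizer x⋆ lying in the interior of K. Assume φ is twice continuously differentiable on a neighborhood of x⋆ with strictly positive definite Hessian ∇²φ(x⋆). Then for any continuous function h : K → ℝ, the self-normalized ratio (∫_K h(x) exp(−φ(x)/δ) dx) / (∫_K exp(−φ(x)/δ) dx) converges to h(x⋆) as δ → 0⁺. -/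
open MeasureTheory Real Filter Set Topology

section GibbsWeight

variable {α : Type*} [TopologicalSpace α] {K : Set α} {φ : α → ℝ} {x₀ : α}

lemma continuousOn_exp_neg_div (hφ : ContinuousOn φ K) (δ : ℝ) :
    ContinuousOn (fun x => Real.exp (-φ x / δ)) K :=
  (hφ.neg.div_const δ).rexp

variable [MeasurableSpace α] [BorelSpace α] {μ : Measure α}

/-- Lower bound for the partition function in terms of a neighborhood of an interior point on
which the potential is at most `m`. -/
lemma exists_mul_exp_le_setIntegral_exp_neg_div [T2Space α] [IsLocallyFiniteMeasure μ]
    [μ.IsOpenPosMeasure] (hK : IsCompact K) (hφ : ContinuousOn φ K) (hx₀ : x₀ ∈ interior K)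
    {m : ℝ} (hm : φ x₀ < m) :
    ∃ c > 0, ∀ δ > 0, c * Real.exp (-m / δ) ≤ ∫ x in K, Real.exp (-φ x / δ) ∂μ := by
  have hnhds : {x | φ x < m} ∩ interior K ∈ 𝓝 x₀ :=
    inter_mem ((hφ.continuousAt (mem_interior_iff_mem_nhds.1 hx₀)).eventually_lt_const hm)
      (isOpen_interior.mem_nhds hx₀)
  obtain ⟨v, hv, v_open, hx₀v⟩ := mem_nhds_iff.1 hnhds
  have hvK : v ⊆ K := fun x hx => interior_subset (hv hx).2
  have hv_top : μ v ≠ ⊤ := ((measure_mono hvK).trans_lt hK.measure_lt_top).ne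
  have hint : ∀ δ, IntegrableOn (fun x => Real.exp (-φ x / δ)) K μ := fun δ =>
    (continuousOn_exp_neg_div hφ δ).integrableOn_compact hK
  refine ⟨μ.real v, ENNReal.toReal_pos (v_open.measure_pos μ ⟨x₀, hx₀v⟩).ne' hv_top,
    fun δ hδ => ?_⟩
  calc μ.real v * Real.exp (-m / δ) = ∫ _ in v, Real.exp (-m / δ) ∂μ := by simp
    _ ≤ ∫ x in v, Real.exp (-φ x / δ) ∂μ := by
        refine setIntegral_mono_on (integrableOn_const hv_top) ((hint δ).mono_set hvK)
          v_open.measurableSet fun x hx => ?_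
        have : φ x < m := (hv hx).1
        gcongr
    _ ≤ ∫ x in K, Real.exp (-φ x / δ) ∂μ :=
        setIntegral_mono_set (hint δ) (Eventually.of_forall fun x => (Real.exp_pos _).le)
          hvK.eventuallyLE

/-- Away from the unique minimizer of the potential, the normalized Gibbs density tends to zero
uniformly as the temperature tends to zero. -/
lemma tendstoUniformlyOn_gibbs_density [T2Space α] [IsLocallyFiniteMeasure μ]
    [μ.IsOpenPosMeasure] (hK : IsCompact K) (hφ : ContinuousOn φ K) (hx₀ : x₀ ∈ interior K)
    (hmin : ∀ x ∈ K, x ≠ x₀ → φ x₀ < φ x) {u : Set α} (hu : IsOpen u) (hx₀u : x₀ ∈ u) :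
    TendstoUniformlyOn
      (fun δ x => (∫ y in K, Real.exp (-φ y / δ) ∂μ)⁻¹ * Real.exp (-φ x / δ)) 0
      (𝓝[>] (0 : ℝ)) (K \ u) := by
  rcases (K \ u).eq_empty_or_nonempty with hempty | hne
  · rw [hempty]
    exact tendstoUniformlyOn_empty
  obtain ⟨x₁, hx₁, hx₁min⟩ := (hK.diff hu).exists_isMinOn hne (hφ.mono sdiff_subset)
  obtain ⟨m, hm₀, hm₁⟩ := exists_between (hmin x₁ hx₁.1 fun h => hx₁.2 (h ▸ hx₀u))
  obtain ⟨c, hc, hZ⟩ := exists_mul_exp_le_setIntegral_exp_neg_div (μ := μ) hK hφ hx₀ hm₀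
  have hlim : Tendsto (fun δ : ℝ => c⁻¹ * Real.exp (-(φ x₁ - m) * δ⁻¹)) (𝓝[>] 0) (𝓝 0) := by
    have := Real.tendsto_exp_atBot.comp
      (tendsto_inv_nhdsGT_zero.const_mul_atTop_of_neg (neg_lt_zero.2 (sub_pos.2 hm₁)))
    simpa using this.const_mul c⁻¹
  refine Metric.tendstoUniformlyOn_iff.2 fun ε hε => ?_
  filter_upwards [hlim.eventually_lt_const hε, self_mem_nhdsWithin] with δ hδε hδ x hx
  replace hδ : 0 < δ := hδ
  have hlow := hZ δ hδ
  have hcm : 0 < c * Real.exp (-m / δ) := by positivity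
  have hφx : φ x₁ ≤ φ x := hx₁min hx
  have hpos : 0 ≤ (∫ y in K, Real.exp (-φ y / δ) ∂μ)⁻¹ * Real.exp (-φ x / δ) :=
    mul_nonneg (inv_nonneg.2 (hcm.le.trans hlow)) (Real.exp_pos _).le
  rw [Pi.zero_apply, dist_zero_left, Real.norm_of_nonneg hpos]
  calc (∫ y in K, Real.exp (-φ y / δ) ∂μ)⁻¹ * Real.exp (-φ x / δ)
      ≤ (c * Real.exp (-m / δ))⁻¹ * Real.exp (-φ x₁ / δ) := by gcongr
    _ = c⁻¹ * Real.exp (-(φ x₁ - m) * δ⁻¹) := by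
        rw [mul_inv, ← Real.exp_neg, mul_assoc, ← Real.exp_add]
        congr 2
        ring
    _ < ε := hδε

/-- Gibbs averages over a compact set concentrate at an interior unique minimizer of the potential
as the temperature tends to zero. -/
theorem tendsto_gibbs_average [T2Space α] [TopologicalSpace.PseudoMetrizableSpace α]
    [IsLocallyFiniteMeasure μ] [μ.IsOpenPosMeasure] (hK : IsCompact K) (hφ : ContinuousOn φ K)
    (hx₀ : x₀ ∈ interior K) (hmin : ∀ x ∈ K, x ≠ x₀ → φ x₀ < φ x) {h : α → ℝ}
    (hh : ContinuousOn h K) :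
    Tendsto (fun δ : ℝ =>
      (∫ x in K, h x * Real.exp (-φ x / δ) ∂μ) / (∫ x in K, Real.exp (-φ x / δ) ∂μ))
      (𝓝[>] 0) (𝓝 (h x₀)) := by
  obtain ⟨c, hc, hZ⟩ :=
    exists_mul_exp_le_setIntegral_exp_neg_div (μ := μ) hK hφ hx₀ (lt_add_one (φ x₀))
  have hZpos : ∀ δ > 0, 0 < ∫ x in K, Real.exp (-φ x / δ) ∂μ := fun δ hδ =>
    (by positivity : 0 < c * Real.exp (-(φ x₀ + 1) / δ)).trans_le (hZ δ hδ)
  have key := tendsto_setIntegral_peak_smul_of_integrableOn_of_tendsto (μ := μ) (s := K) (t := K)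
    (φ := fun δ x => (∫ y in K, Real.exp (-φ y / δ) ∂μ)⁻¹ * Real.exp (-φ x / δ)) (g := h)
    (l := 𝓝[>] (0 : ℝ)) hK.measurableSet hK.measurableSet Subset.rfl self_mem_nhdsWithin
    hK.measure_lt_top.ne ?_
    (fun u hu hx₀u => tendstoUniformlyOn_gibbs_density hK hφ hx₀ hmin hu hx₀u) ?_ ?_
    (hh.integrableOn_compact hK) (hh x₀ (interior_subset hx₀))
  · refine key.congr fun δ => ?_
    rw [div_eq_inv_mul, ← integral_const_mul]
    refine integral_congr_ae (Eventually.of_forall fun x => ?_)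
    simp only [smul_eq_mul]
    ring
  · filter_upwards [self_mem_nhdsWithin] with δ hδ x _
    exact mul_nonneg (inv_nonneg.2 (hZpos δ hδ).le) (Real.exp_pos _).le
  · refine tendsto_const_nhds.congr' ?_
    filter_upwards [self_mem_nhdsWithin] with δ hδ
    rw [integral_const_mul, inv_mul_cancel₀ (hZpos δ hδ).ne']
  · exact Eventually.of_forall fun δ =>
      ((continuousOn_exp_neg_div hφ δ).const_mul _).aestronglyMeasurable_of_isCompact hK
        hK.measurableSet

end GibbsWeight

/-- Self-normalized Laplace approximation, compact case. -/
theorem laplace_self_normalized_compact {d : ℕ}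
    (K : Set (EuclideanSpace ℝ (Fin d))) (hK : IsCompact K)
    (φ h : EuclideanSpace ℝ (Fin d) → ℝ)
    (hφ : ContinuousOn φ K)
    (xs : EuclideanSpace ℝ (Fin d))
    (hxsK : xs ∈ K) (hxsint : xs ∈ interior K)
    (hmin : ∀ x ∈ K, x ≠ xs → φ xs < φ x)
    (hC2 : ∃ U ∈ 𝓝 xs, ContDiffOn ℝ 2 φ U)
    (hposdef : ∀ v : EuclideanSpace ℝ (Fin d), v ≠ 0 →
      0 < fderiv ℝ (fderiv ℝ φ) xs v v)
    (hh : ContinuousOn h K) :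
    Tendsto (fun δ : ℝ =>
      (∫ x in K, h x * Real.exp (-φ x / δ)) / (∫ x in K, Real.exp (-φ x / δ)))
      (𝓝[>] 0) (𝓝 (h xs)) := by
  exact tendsto_gibbs_average hK hφ hxsint hmin hh
end

section
/- Let f, g : ℝ^d → ℝ be continuous, fix x ∈ ℝ^d, and define φ_x(y) = f(y) + g(x − y). Assume φ_x has a unique global minimizer y_x, that there exists ε > 0 such that the sublevel set S_ε = {y ∈ ℝ^d : φ_x(y) ≤ φ_x(y_x) + ε} is bounded and ∫ exp(−φ_x(y)/ε) dy < ∞, and that there are constants a, q > 0 and a neighborhood U_x of y_x with φ_x(y) − φ_x(y_x) ≤ a‖y − y_x‖₂^q for all y ∈ U_x. Then for any continuous h : ℝ^d → ℝ with ∫ |h(y)| exp(−d·φ_x(y)/(q·ε)) dy < ∞, the ratio (∫ h(y) exp((−f(y) − g(x−y))/δ) dy) / (∫ exp((−f(y) − g(x−y))/δ) dy) converges to h(y_x) as δ → 0⁺. -/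
open MeasureTheory Real Filter Set Topology

/-- A continuous function vanishing at `z`, positive elsewhere, with a bounded sublevel set at a
positive level, is bounded below by a positive constant off every open neighbourhood of `z`. -/
lemma exists_pos_le_off_of_isBounded_sublevel {E : Type*} [MetricSpace E] [ProperSpace E]
    {ψ : E → ℝ} (hψ : Continuous ψ) {z : E} (hpos : ∀ y, y ≠ z → 0 < ψ y)
    {ε : ℝ} (hε : 0 < ε) (hbdd : Bornology.IsBounded {y | ψ y ≤ ε})
    {V : Set E} (hV : IsOpen V) (hzV : z ∈ V) :
    ∃ m, 0 < m ∧ ∀ y, y ∉ V → m ≤ ψ y := by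
  have hK : IsCompact ({y | ψ y ≤ ε} \ V) :=
    (Metric.isCompact_of_isClosed_isBounded (isClosed_le hψ continuous_const) hbdd).diff hV
  have hne : ∀ y, y ∉ V → y ≠ z := fun y hy hyz => hy (hyz ▸ hzV)
  rcases ({y | ψ y ≤ ε} \ V).eq_empty_or_nonempty with hemp | hnon
  · refine ⟨ε, hε, fun y hy => ?_⟩
    by_contra! hlt
    have : y ∈ {y | ψ y ≤ ε} \ V := ⟨hlt.le, hy⟩
    simp [hemp] at this
  · obtain ⟨w, hw, hwmin⟩ := hK.exists_isMinOn hnon hψ.continuousOn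
    refine ⟨min ε (ψ w), lt_min hε (hpos w (hne w hw.2)), fun y hy => ?_⟩
    rcases le_total (ψ y) ε with hle | hle
    · exact (min_le_right _ _).trans (hwmin ⟨hle, hy⟩)
    · exact (min_le_left _ _).trans hle

section Laplace

variable {E : Type*} [MetricSpace E] [MeasurableSpace E] [BorelSpace E]
  {μ : Measure E}

/-- Integrability against `exp (-c ψ)` with `ψ ≥ 0` passes to larger exponents. -/
lemma integrable_mul_exp_neg_of_le {ψ : E → ℝ} (hψ : Continuous ψ)
    (h0 : ∀ y, 0 ≤ ψ y) {k : E → ℝ} (hk : Continuous k) {c t : ℝ} (hct : c ≤ t)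
    (hint : Integrable (fun y => |k y| * exp (-(c * ψ y))) μ) :
    Integrable (fun y => k y * exp (-(t * ψ y))) μ := by
  refine hint.mono' (by fun_prop) (ae_of_all _ fun y => ?_)
  rw [norm_mul, norm_eq_abs, norm_eq_abs, abs_exp]
  gcongr
  exact h0 y

/-- Exponential averages concentrating at the unique minimizer `z` of `ψ` send continuous
functions vanishing at `z` to zero. -/
lemma tendsto_integral_mul_exp_div_integral_exp_zero [ProperSpace E] [μ.IsOpenPosMeasure]
    [IsFiniteMeasureOnCompacts μ]
    {ψ : E → ℝ} (hψ : Continuous ψ) {z : E} (hz : ψ z = 0) (hpos : ∀ y, y ≠ z → 0 < ψ y)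
    {ε : ℝ} (hε : 0 < ε) (hbdd : Bornology.IsBounded {y | ψ y ≤ ε})
    {k : E → ℝ} (hk : Continuous k) (hkz : k z = 0) {c : ℝ}
    (hZ : Integrable (fun y => exp (-(c * ψ y))) μ)
    (hint : Integrable (fun y => |k y| * exp (-(c * ψ y))) μ) :
    Tendsto (fun t : ℝ => (∫ y, k y * exp (-(t * ψ y)) ∂μ) / ∫ y, exp (-(t * ψ y)) ∂μ)
      atTop (𝓝 0) := by
  have h0 : ∀ y, 0 ≤ ψ y := fun y => by
    by_cases hy : y = z
    · rw [hy, hz]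
    · exact (hpos y hy).le
  rw [Metric.tendsto_nhds]
  intro η hη
  obtain ⟨m, hm, hmV⟩ := exists_pos_le_off_of_isBounded_sublevel hψ hpos hε hbdd
    (V := {y | |k y| < η / 2}) (isOpen_lt hk.abs continuous_const) (by simp [hkz, hη])
  obtain ⟨r, hr, hrW⟩ := Metric.isOpen_iff.1
    (isOpen_lt hψ (continuous_const : Continuous fun _ => m / 2)) z (by simp [hz, hm])
  set v : ℝ := μ.real (Metric.ball z r) with hv_def
  have hfin : μ (Metric.ball z r) ≠ ⊤ := measure_ball_lt_top.ne
  have hv : 0 < v := ENNReal.toReal_pos (Metric.measure_ball_pos μ z hr).ne' hfin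
  set K : ℝ := ∫ y, |k y| * exp (-(c * ψ y)) ∂μ with hK_def
  have hK : 0 ≤ K := integral_nonneg fun y => by positivity
  have hlim : Tendsto (fun t : ℝ => exp (m * c) * K / v * exp (-(m / 2 * t))) atTop (𝓝 0) := by
    have : Tendsto (fun t : ℝ => exp (-(m / 2 * t))) atTop (𝓝 0) :=
      tendsto_exp_neg_atTop_nhds_zero.comp (tendsto_id.const_mul_atTop (by positivity))
    simpa using this.const_mul (exp (m * c) * K / v)
  filter_upwards [hlim.eventually_lt_const (half_pos hη), eventually_ge_atTop c,
    eventually_ge_atTop 0] with t ht hct ht0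
  have hZt : Integrable (fun y => exp (-(t * ψ y))) μ := by
    simpa using integrable_mul_exp_neg_of_le hψ h0 (k := fun _ => 1) continuous_const hct
      (by simpa using hZ)
  have hlow : v * exp (-(m / 2 * t)) ≤ ∫ y, exp (-(t * ψ y)) ∂μ := by
    calc v * exp (-(m / 2 * t)) = ∫ _ in Metric.ball z r, exp (-(m / 2 * t)) ∂μ := by
          simp [hv_def]
      _ ≤ ∫ y in Metric.ball z r, exp (-(t * ψ y)) ∂μ := by
          refine setIntegral_mono_on (integrableOn_const hfin) hZt.integrableOn
            measurableSet_ball fun y hy => ?_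
          have : ψ y < m / 2 := hrW hy
          exact exp_le_exp.2 (by nlinarith)
      _ ≤ ∫ y, exp (-(t * ψ y)) ∂μ :=
          setIntegral_le_integral hZt (ae_of_all _ fun y => (exp_pos _).le)
  have hup : |∫ y, k y * exp (-(t * ψ y)) ∂μ| ≤
      η / 2 * (∫ y, exp (-(t * ψ y)) ∂μ) + exp (-(m * (t - c))) * K := by
    rw [hK_def, ← integral_const_mul, ← integral_const_mul,
      ← integral_add (hZt.const_mul _) (hint.const_mul _), ← norm_eq_abs]
    refine norm_integral_le_of_norm_le ((hZt.const_mul _).add (hint.const_mul _))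
      (ae_of_all _ fun y => ?_)
    rw [norm_mul, norm_eq_abs, norm_eq_abs, abs_exp]
    by_cases hy : |k y| < η / 2
    · have h1 : |k y| * exp (-(t * ψ y)) ≤ η / 2 * exp (-(t * ψ y)) := by gcongr
      have h2 : 0 ≤ exp (-(m * (t - c))) * (|k y| * exp (-(c * ψ y))) := by positivity
      exact h1.trans (le_add_of_nonneg_right h2)
    · have hmy : m ≤ ψ y := hmV y hy
      have h1 : exp (-(t * ψ y)) ≤ exp (-(m * (t - c))) * exp (-(c * ψ y)) := by
        rw [← exp_add]
        gcongr
        nlinarith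
      have h2 : |k y| * exp (-(t * ψ y)) ≤
          exp (-(m * (t - c))) * (|k y| * exp (-(c * ψ y))) := by
        calc _ ≤ |k y| * (exp (-(m * (t - c))) * exp (-(c * ψ y))) := by gcongr
          _ = _ := by ring
      exact h2.trans (le_add_of_nonneg_left (by positivity))
  have hZpos : 0 < ∫ y, exp (-(t * ψ y)) ∂μ := lt_of_lt_of_le (by positivity) hlow
  rw [dist_zero_right, norm_eq_abs, abs_div, abs_of_pos hZpos, div_lt_iff₀ hZpos]
  have hsplit : exp (-(m * (t - c))) * K =
      exp (m * c) * K / v * exp (-(m / 2 * t)) * (v * exp (-(m / 2 * t))) := by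
    have : exp (-(m * (t - c))) = exp (m * c) * exp (-(m / 2 * t)) * exp (-(m / 2 * t)) := by
      rw [← exp_add, ← exp_add]
      congr 1
      ring
    rw [this]
    field_simp
  have hfirst : exp (-(m * (t - c))) * K ≤
      exp (m * c) * K / v * exp (-(m / 2 * t)) * ∫ y, exp (-(t * ψ y)) ∂μ := by
    rw [hsplit]
    gcongr
  nlinarith [mul_lt_mul_of_pos_right ht hZpos]

/-- Laplace's principle: exponential averages converge to the value at the unique minimizer. -/
lemma tendsto_integral_mul_exp_div_integral_exp [ProperSpace E] [μ.IsOpenPosMeasure]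
    [IsFiniteMeasureOnCompacts μ]
    {ψ : E → ℝ} (hψ : Continuous ψ) {z : E} (hz : ψ z = 0) (hpos : ∀ y, y ≠ z → 0 < ψ y)
    {ε : ℝ} (hε : 0 < ε) (hbdd : Bornology.IsBounded {y | ψ y ≤ ε})
    {h : E → ℝ} (hh : Continuous h) {b c : ℝ}
    (hZ : Integrable (fun y => exp (-(b * ψ y))) μ)
    (hint : Integrable (fun y => |h y| * exp (-(c * ψ y))) μ) :
    Tendsto (fun t : ℝ => (∫ y, h y * exp (-(t * ψ y)) ∂μ) / ∫ y, exp (-(t * ψ y)) ∂μ)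
      atTop (𝓝 (h z)) := by
  have h0 : ∀ y, 0 ≤ ψ y := fun y => by
    by_cases hy : y = z
    · rw [hy, hz]
    · exact (hpos y hy).le
  have hZt : ∀ t, b ≤ t → Integrable (fun y => exp (-(t * ψ y))) μ := fun t ht => by
    simpa using integrable_mul_exp_neg_of_le hψ h0 (k := fun _ => 1) continuous_const ht
      (by simpa using hZ)
  have hht : ∀ t, c ≤ t → Integrable (fun y => h y * exp (-(t * ψ y))) μ := fun t ht =>
    integrable_mul_exp_neg_of_le hψ h0 hh ht hint
  have hdiff : ∀ t, b ≤ t → c ≤ t →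
      Integrable (fun y => (h y - h z) * exp (-(t * ψ y))) μ := fun t hb hc => by
    simp only [sub_mul]
    exact (hht t hc).sub ((hZt t hb).const_mul (h z))
  have hlim := tendsto_integral_mul_exp_div_integral_exp_zero (μ := μ) hψ hz hpos hε hbdd
    (k := fun y => h y - h z) (by fun_prop) (sub_self _) (hZt (max b c) (le_max_left _ _))
    (by simpa only [abs_mul, abs_exp] using
      (hdiff (max b c) (le_max_left _ _) (le_max_right _ _)).abs)
  have hlim' := hlim.add_const (h z)
  rw [zero_add] at hlim'
  have : NeZero μ := ⟨fun hμ => by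
    have hball := Metric.measure_ball_pos μ z one_pos
    simp [hμ] at hball⟩
  refine hlim'.congr' ?_
  filter_upwards [eventually_ge_atTop b, eventually_ge_atTop c] with t hb hc
  have hne : (∫ y, exp (-(t * ψ y)) ∂μ) ≠ 0 := (integral_exp_pos (hZt t hb)).ne'
  have heq : ∫ y, (h y - h z) * exp (-(t * ψ y)) ∂μ =
      (∫ y, h y * exp (-(t * ψ y)) ∂μ) - h z * ∫ y, exp (-(t * ψ y)) ∂μ := by
    simp only [sub_mul]
    rw [integral_sub (hht t hc) ((hZt t hb).const_mul _), integral_const_mul]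
  rw [heq]
  field_simp
  ring

end Laplace

/-- Laplace approximation for infimal convolutions (Corollary 1, general `h`). -/
theorem laplace_inf_conv {d : ℕ}
    (f g : EuclideanSpace ℝ (Fin d) → ℝ)
    (hf : Continuous f) (hg : Continuous g)
    (x yx : EuclideanSpace ℝ (Fin d))
    (hmin : ∀ y, y ≠ yx → f yx + g (x - yx) < f y + g (x - y))
    (ε : ℝ) (hε : 0 < ε)
    (hbdd : Bornology.IsBounded
      {y : EuclideanSpace ℝ (Fin d) | f y + g (x - y) ≤ f yx + g (x - yx) + ε})
    (hintε : Integrable (fun y => Real.exp (-(f y + g (x - y)) / ε)))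
    (a q : ℝ) (ha : 0 < a) (hq : 0 < q)
    (U : Set (EuclideanSpace ℝ (Fin d))) (hU : U ∈ 𝓝 yx)
    (hholder : ∀ y ∈ U,
      (f y + g (x - y)) - (f yx + g (x - yx)) ≤ a * ‖y - yx‖ ^ q)
    (h : EuclideanSpace ℝ (Fin d) → ℝ) (hh : Continuous h)
    (hint : Integrable
      (fun y => |h y| * Real.exp (-(d : ℝ) * (f y + g (x - y)) / (q * ε)))) :
    Tendsto (fun δ : ℝ =>
      (∫ y, h y * Real.exp ((-f y - g (x - y)) / δ)) /
        (∫ y, Real.exp ((-f y - g (x - y)) / δ)))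
      (𝓝[>] 0) (𝓝 (h yx)) := by
  set p : ℝ := f yx + g (x - yx) with hp
  have hshift : ∀ t y, exp (-(t * (f y + g (x - y) - p))) =
      exp (t * p) * exp (-(t * (f y + g (x - y)))) := fun t y => by
    rw [← exp_add]
    congr 1
    ring
  have hlim := tendsto_integral_mul_exp_div_integral_exp (μ := volume)
    (ψ := fun y => f y + g (x - y) - p) (by fun_prop) (z := yx) (by simp [hp])
    (fun y hy => sub_pos.2 (hmin y hy)) hε
    (by simpa only [sub_le_iff_le_add'] using hbdd) hh (b := 1 / ε) (c := d / (q * ε))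
    (by
      simp only [hshift]
      convert hintε.const_mul (exp (1 / ε * p)) using 4
      ring)
    (by
      simp only [hshift]
      convert hint.const_mul (exp (d / (q * ε) * p)) using 2 with y
      rw [mul_left_comm]
      congr 3
      ring)
  refine (hlim.comp tendsto_inv_nhdsGT_zero).congr fun δ => ?_
  have hexp : ∀ y, exp (-(δ⁻¹ * (f y + g (x - y) - p))) =
      exp (δ⁻¹ * p) * exp ((-f y - g (x - y)) / δ) := fun y => by
    rw [hshift]
    congr 2
    ring
  simp only [Function.comp_apply, hexp, mul_left_comm (h _), integral_const_mul]
  rw [mul_div_mul_left _ _ (exp_ne_zero _)]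
end

section
/- Let f, g : ℝ^d → ℝ be continuous, fix x ∈ ℝ^d, and define φ_x(y) = f(y) + g(x − y). Assume φ_x has a unique global minimizer y_x, that there exists ε > 0 such that the sublevel set S_ε = {y ∈ ℝ^d : φ_x(y) ≤ φ_x(y_x) + ε} is bounded, that there are constants a, q > 0 and a neighborhood U_x of y_x with φ_x(y) − φ_x(y_x) ≤ a‖y − y_x‖₂^q for all y ∈ U_x, and that ∫ ‖y‖_∞ exp((−f(y) − g(x−y))/ε) dy < ∞. Then the vector y_x^δ = (∫ y exp((−f(y) − g(x−y))/δ) dy) / (∫ exp((−f(y) − g(x−y))/δ) dy), defined coordinatewise, converges to y_x as δ → 0⁺. -/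
open MeasureTheory Real Filter Set Topology

section LaplaceMethod

variable {α : Type*} [TopologicalSpace α] {ψ : α → ℝ} {x₀ : α} {b : ℝ}

/-- A continuous function with a unique minimizer and a compact sublevel set is bounded
away from its minimum outside every neighborhood of the minimizer. -/
theorem exists_forall_le_of_notMem_of_isCompact_sublevel (hψ : Continuous ψ)
    (hmin : ∀ y, y ≠ x₀ → ψ x₀ < ψ y) (hb : ψ x₀ < b) (hK : IsCompact {y | ψ y ≤ b})
    {u : Set α} (hu : IsOpen u) (hx₀ : x₀ ∈ u) :
    ∃ m, ψ x₀ < m ∧ m ≤ b ∧ ∀ y ∉ u, m ≤ ψ y := by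
  rcases eq_empty_or_nonempty ({y | ψ y ≤ b} \ u) with h | h
  · refine ⟨b, hb, le_rfl, fun y hy => ?_⟩
    by_contra! hyb
    exact (h ▸ (⟨hyb.le, hy⟩ : y ∈ {y | ψ y ≤ b} \ u) : y ∈ (∅ : Set α))
  · obtain ⟨z, hz, hzmin⟩ := (hK.diff hu).exists_isMinOn h hψ.continuousOn
    refine ⟨ψ z, hmin z fun e => hz.2 (e ▸ hx₀), hz.1, fun y hy => ?_⟩
    rcases le_total (ψ y) b with hyb | hyb
    · exact hzmin ⟨hyb, hy⟩
    · exact hz.1.trans hyb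

variable [T2Space α] [MeasurableSpace α] [BorelSpace α] {μ : Measure α}
  [μ.IsOpenPosMeasure] [IsFiniteMeasureOnCompacts μ]

/-- The functions `exp (-s ψ)`, normalized on a compact sublevel set of `ψ`, form a family of
peak functions at the unique minimizer of `ψ` as `s → ∞`. -/
theorem tendsto_integral_exp_neg_mul_smul_of_unique_minimum
    {E : Type*} [NormedAddCommGroup E] [NormedSpace ℝ E] [CompleteSpace E] {G : α → E}
    (hψ : Continuous ψ) (hmin : ∀ y, y ≠ x₀ → ψ x₀ < ψ y) (hb : ψ x₀ < b)
    (hK : IsCompact {y | ψ y ≤ b}) (hG : Integrable G μ) (hGc : ContinuousAt G x₀) :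
    Tendsto (fun s : ℝ => (∫ y in {y | ψ y ≤ b}, exp (-(s * ψ y)) ∂μ)⁻¹ •
      ∫ y, exp (-(s * ψ y)) • G y ∂μ) atTop (𝓝 (G x₀)) := by
  set t : Set α := {y | ψ y ≤ b}
  have hcont (s : ℝ) : Continuous fun y => exp (-(s * ψ y)) := by fun_prop
  have hI (s : ℝ) : IntegrableOn (fun y => exp (-(s * ψ y))) t μ :=
    (hcont s).continuousOn.integrableOn_compact hK
  have hlower {m : ℝ} (hm : ψ x₀ < m) (hmb : m ≤ b) :
      ∃ v, 0 < v ∧ ∀ s, 0 ≤ s → v * exp (-(s * m)) ≤ ∫ y in t, exp (-(s * ψ y)) ∂μ := by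
    have hopen : IsOpen {y | ψ y < m} := isOpen_lt hψ continuous_const
    have hsub : {y | ψ y < m} ⊆ t := fun y hy => (le_of_lt hy).trans hmb
    have hfin : μ {y | ψ y < m} ≠ ⊤ := measure_ne_top_of_subset hsub hK.measure_lt_top.ne
    refine ⟨μ.real {y | ψ y < m},
      ENNReal.toReal_pos (hopen.measure_pos μ ⟨x₀, hm⟩).ne' hfin, fun s hs => ?_⟩
    calc μ.real {y | ψ y < m} * exp (-(s * m))
        = ∫ _ in {y | ψ y < m}, exp (-(s * m)) ∂μ := by simp
      _ ≤ ∫ y in {y | ψ y < m}, exp (-(s * ψ y)) ∂μ := by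
        refine setIntegral_mono_on (integrableOn_const hfin) ((hI s).mono_set hsub)
          hopen.measurableSet fun y hy => ?_
        have : ψ y ≤ m := le_of_lt hy
        gcongr
      _ ≤ ∫ y in t, exp (-(s * ψ y)) ∂μ :=
        setIntegral_mono_set (hI s) (ae_of_all _ fun y => (exp_pos _).le) hsub.eventuallyLE
  have hpos : ∀ s, 0 ≤ s → 0 < ∫ y in t, exp (-(s * ψ y)) ∂μ := by
    obtain ⟨v, hv, hle⟩ := hlower hb le_rfl
    exact fun s hs => lt_of_lt_of_le (by positivity) (hle s hs)
  have key := tendsto_integral_peak_smul_of_integrable_of_tendsto (μ := μ) (l := atTop)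
    (φ := fun s y => (∫ y in t, exp (-(s * ψ y)) ∂μ)⁻¹ * exp (-(s * ψ y)))
    (t := t) hK.measurableSet
    (mem_of_superset ((isOpen_lt hψ continuous_const).mem_nhds hb)
      fun y (hy : ψ y < b) => (hy.le : ψ y ≤ b))
    hK.measure_lt_top.ne ?_ ?_ ?_ ?_ hG hGc
  · simpa only [mul_smul, integral_smul] using key
  · filter_upwards [eventually_ge_atTop 0] with s hs y
    have := hpos s hs
    positivity
  · intro u hu hx₀
    obtain ⟨m, hm, hmb, hmu⟩ :=
      exists_forall_le_of_notMem_of_isCompact_sublevel hψ hmin hb hK hu hx₀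
    obtain ⟨m', hm', hm'm⟩ := exists_between hm
    obtain ⟨v, hv, hle⟩ := hlower hm' (hm'm.le.trans hmb)
    have hlim : Tendsto (fun s : ℝ => v⁻¹ * exp (-(s * (m - m')))) atTop (𝓝 0) := by
      have : Tendsto (fun s : ℝ => s * (m - m')) atTop atTop :=
        tendsto_id.atTop_mul_const (sub_pos.2 hm'm)
      simpa using (tendsto_exp_neg_atTop_nhds_zero.comp this).const_mul v⁻¹
    rw [Metric.tendstoUniformlyOn_iff]
    intro η hη
    filter_upwards [hlim.eventually_lt_const hη, eventually_ge_atTop 0] with s hsη hs y hy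
    have hps := hpos s hs
    have hmy := hmu y hy
    rw [Pi.zero_apply, dist_zero_left, Real.norm_of_nonneg (by positivity)]
    refine lt_of_le_of_lt ?_ hsη
    calc (∫ y in t, exp (-(s * ψ y)) ∂μ)⁻¹ * exp (-(s * ψ y))
        ≤ (v * exp (-(s * m')))⁻¹ * exp (-(s * m)) := by
          gcongr
          exact hle s hs
      _ = v⁻¹ * exp (-(s * (m - m'))) := by
          rw [mul_inv, ← exp_neg, mul_assoc, ← exp_add]
          congr 2
          ring
  · refine tendsto_const_nhds.congr' ?_
    filter_upwards [eventually_ge_atTop 0] with s hs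
    rw [integral_const_mul, inv_mul_cancel₀ (hpos s hs).ne']
  · exact Eventually.of_forall fun s => ((hcont s).const_mul _).measurable.aestronglyMeasurable

/-- **Laplace's method** for Gibbs averages: the mean of `u` under the density proportional to
`exp (-ψ / δ)` tends to the value of `u` at the unique minimizer of `ψ` as `δ → 0⁺`. -/
theorem tendsto_gibbs_average_of_unique_minimum
    (hψ : Continuous ψ) (hmin : ∀ y, y ≠ x₀ → ψ x₀ < ψ y) (hb : ψ x₀ < b)
    (hK : IsCompact {y | ψ y ≤ b}) {ε : ℝ} {u : α → ℝ} (hu : ContinuousAt u x₀)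
    (hI : Integrable (fun y => exp (-ψ y / ε)) μ)
    (huI : Integrable (fun y => u y * exp (-ψ y / ε)) μ) :
    Tendsto (fun δ : ℝ => (∫ y, u y * exp (-ψ y / δ) ∂μ) / ∫ y, exp (-ψ y / δ) ∂μ)
      (𝓝[>] 0) (𝓝 (u x₀)) := by
  have hc : ContinuousAt (fun y => exp (-ψ y / ε)) x₀ := by fun_prop
  have hnum := tendsto_integral_exp_neg_mul_smul_of_unique_minimum hψ hmin hb hK huI (hu.mul hc)
  have hden := tendsto_integral_exp_neg_mul_smul_of_unique_minimum hψ hmin hb hK hI hc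
  have hs : Tendsto (fun δ : ℝ => δ⁻¹ - ε⁻¹) (𝓝[>] 0) atTop :=
    tendsto_atTop_add_const_right _ _ tendsto_inv_nhdsGT_zero
  have hlim := (hnum.div hden (exp_pos _).ne').comp hs
  rw [mul_div_cancel_right₀ _ (exp_pos _).ne'] at hlim
  have hne : ∀ᶠ δ : ℝ in 𝓝[>] 0,
      (∫ y in {y | ψ y ≤ b}, exp (-((δ⁻¹ - ε⁻¹) * ψ y)) ∂μ)⁻¹ ≠ 0 := by
    filter_upwards [hs.eventually (hden.eventually_ne (exp_pos _).ne')] with δ hδ h0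
    exact hδ (by rw [h0, zero_smul])
  refine hlim.congr' ?_
  filter_upwards [hne] with δ hδ
  have hexp (y : α) :
      exp (-((δ⁻¹ - ε⁻¹) * ψ y)) * exp (-ψ y / ε) = exp (-ψ y / δ) := by
    rw [← exp_add]
    congr 1
    ring
  simp only [Function.comp_apply, Pi.div_apply, smul_eq_mul, mul_left_comm _ (u _), hexp]
  exact mul_div_mul_left _ _ hδ

end LaplaceMethod

/-- A continuous function on a finite-dimensional normed space is integrable as soon as its product with the
pullback of the norm along a linear homeomorphism is. -/
theorem Continuous.integrable_of_norm_mul {E F : Type*} [NormedAddCommGroup E] [NormedSpace ℝ E]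
    [MeasurableSpace E] [BorelSpace E] {μ : Measure E} [IsFiniteMeasureOnCompacts μ]
    [NormedAddCommGroup F] [NormedSpace ℝ F] [ProperSpace F] (e : E ≃L[ℝ] F)
    {w : E → ℝ} (hw : Continuous w) (h : Integrable (fun y => ‖e y‖ * w y) μ) :
    Integrable w μ := by
  have hcpt : IsCompact (e ⁻¹' Metric.closedBall 0 1) :=
    e.toHomeomorph.isCompact_preimage.2 (isCompact_closedBall 0 1)
  rw [← integrableOn_univ, ← union_compl_self (e ⁻¹' Metric.closedBall 0 1)]
  refine (hw.continuousOn.integrableOn_compact hcpt).union ?_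
  refine Integrable.mono h.integrableOn hw.aestronglyMeasurable ?_
  filter_upwards [ae_restrict_mem hcpt.measurableSet.compl] with y hy
  have hy1 : 1 ≤ ‖e y‖ := by
    simp only [mem_compl_iff, mem_preimage, mem_closedBall_zero_iff, not_le] at hy
    exact hy.le
  rw [norm_mul, norm_norm]
  exact le_mul_of_one_le_left (norm_nonneg _) hy1

/-- Laplace approximation for infimal convolutions (Corollary 1, coordinate
maps): the vector `y_x^δ` converges to the minimizer `y_x` as `δ → 0⁺`. -/
theorem laplace_inf_conv_vector {d : ℕ}
    (f g : EuclideanSpace ℝ (Fin d) → ℝ)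
    (hf : Continuous f) (hg : Continuous g)
    (x yx : EuclideanSpace ℝ (Fin d))
    (hmin : ∀ y, y ≠ yx → f yx + g (x - yx) < f y + g (x - y))
    (ε : ℝ) (hε : 0 < ε)
    (hbdd : Bornology.IsBounded
      {y : EuclideanSpace ℝ (Fin d) | f y + g (x - y) ≤ f yx + g (x - yx) + ε})
    (a q : ℝ) (ha : 0 < a) (hq : 0 < q)
    (U : Set (EuclideanSpace ℝ (Fin d))) (hU : U ∈ 𝓝 yx)
    (hholder : ∀ y ∈ U,
      (f y + g (x - y)) - (f yx + g (x - yx)) ≤ a * ‖y - yx‖ ^ q)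
    (hint : Integrable (fun y : EuclideanSpace ℝ (Fin d) =>
      ‖(EuclideanSpace.equiv (Fin d) ℝ) y‖ *
        Real.exp ((-f y - g (x - y)) / ε))) :
    Tendsto (fun δ : ℝ =>
      (EuclideanSpace.equiv (Fin d) ℝ).symm (fun i =>
        (∫ y : EuclideanSpace ℝ (Fin d),
            y i * Real.exp ((-f y - g (x - y)) / δ)) /
          (∫ y : EuclideanSpace ℝ (Fin d),
            Real.exp ((-f y - g (x - y)) / δ))))
      (𝓝[>] 0) (𝓝 yx) := by
  set ψ : EuclideanSpace ℝ (Fin d) → ℝ := fun y => f y + g (x - y) with hψdef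
  have hneg (y : EuclideanSpace ℝ (Fin d)) : -f y - g (x - y) = -ψ y := by
    simp only [hψdef]
    ring
  simp only [hneg] at hint ⊢
  have hψ : Continuous ψ := by fun_prop
  have hK : IsCompact {y | ψ y ≤ ψ yx + ε} :=
    Metric.isCompact_of_isClosed_isBounded (isClosed_le hψ continuous_const) hbdd
  have hI : Integrable fun y => exp (-ψ y / ε) :=
    Continuous.integrable_of_norm_mul _ (by fun_prop) hint
  have hcoord (i : Fin d) : Integrable fun y : EuclideanSpace ℝ (Fin d) =>
      y i * exp (-ψ y / ε) := by
    refine hint.mono (by fun_prop) (ae_of_all _ fun y => ?_)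
    rw [norm_mul, norm_mul, norm_norm]
    gcongr
    exact norm_le_pi_norm ((EuclideanSpace.equiv (Fin d) ℝ) y) i
  have hpi := tendsto_pi_nhds.2 fun i => tendsto_gibbs_average_of_unique_minimum
    (u := fun y : EuclideanSpace ℝ (Fin d) => y i) hψ hmin (lt_add_of_pos_right _ hε) hK
    (by fun_prop) hI (hcoord i)
  exact ((EuclideanSpace.equiv (Fin d) ℝ).symm.continuous.tendsto _).comp hpi
end

section
/- Let K ⊆ ℝ^d be a closed set and let φ : K → ℝ be a continuous function with a unique global minimizer x⋆ lying on the boundary of K. Assume there exists ε > 0 such that the sublevel set S_ε = {x ∈ K : φ(x) ≤ φ(x⋆) + ε} is bounded and ∫_K exp(−φ(x)/ε) dx < ∞, and that there are constants a, q > 0 and a neighborhood U of x⋆ with φ(x) − φ(x⋆) ≤ a‖x − x⋆‖₂^q for all x ∈ K ∩ U. Assume further there exists r₀ > 0 such that K ∩ B(x⋆, r₀) has positive Lebesgue measure and K is locally star-shaped about x⋆ at scale r₀: for every x ∈ K ∩ B(x⋆, r₀) and every α ∈ [0,1], the point αx + (1−α)x⋆ lies in K. Then for any continuous h : K → ℝ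 with ∫_K |h(x)| exp(−d·φ(x)/(q·ε)) dx < ∞, the ratio (∫_K h(x) exp(−φ(x)/δ) dx) / (∫_K exp(−φ(x)/δ) dx) converges to h(x⋆) as δ → 0⁺. -/
open MeasureTheory Real Filter Set Topology Metric

/-- Abstract Laplace principle: the Gibbs averages of `g` at inverse temperature `t` tend to zero
if `g` is small wherever the nonnegative potential `ψ` is small. -/
theorem tendsto_gibbs_average_zero {α : Type*} [MeasurableSpace α] {μ : Measure α}
    {ψ g : α → ℝ} {M : ℝ} (hψm : AEStronglyMeasurable ψ μ) (hgm : AEStronglyMeasurable g μ)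
    (hψ : ∀ᵐ x ∂μ, 0 ≤ ψ x)
    (hexp : Integrable (fun x => Real.exp (-(M * ψ x))) μ)
    (hg : Integrable (fun x => |g x| * Real.exp (-(M * ψ x))) μ)
    (hpos : ∀ η > 0, μ {x | ψ x ≤ η} ≠ 0)
    (hsmall : ∀ γ > 0, ∃ η > 0, ∀ᵐ x ∂μ, |g x| ≤ γ ∨ η ≤ ψ x) :
    (∀ t, M ≤ t → Integrable (fun x => Real.exp (-(t * ψ x))) μ ∧
      Integrable (fun x => g x * Real.exp (-(t * ψ x))) μ) ∧
    (∀ᶠ t in atTop, 0 < ∫ x, Real.exp (-(t * ψ x)) ∂μ) ∧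
    Tendsto (fun t : ℝ =>
      (∫ x, g x * Real.exp (-(t * ψ x)) ∂μ) / (∫ x, Real.exp (-(t * ψ x)) ∂μ))
      atTop (𝓝 0) := by
  have hmt : ∀ t, AEStronglyMeasurable (fun x => Real.exp (-(t * ψ x))) μ := fun t =>
    Real.continuous_exp.comp_aestronglyMeasurable (hψm.const_mul t).neg
  have hint : ∀ t, M ≤ t → Integrable (fun x => Real.exp (-(t * ψ x))) μ ∧
      Integrable (fun x => g x * Real.exp (-(t * ψ x))) μ := by
    intro t ht
    refine ⟨hexp.mono' (hmt t) ?_, hg.mono' (hgm.mul (hmt t)) ?_⟩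
    · filter_upwards [hψ] with x hx
      rw [Real.norm_eq_abs, Real.abs_exp]
      gcongr
    · filter_upwards [hψ] with x hx
      rw [Real.norm_eq_abs, abs_mul, Real.abs_exp]
      gcongr
  have hlower : ∀ η > 0, ∃ v > 0, ∀ t > 0, M ≤ t →
      Real.exp (-(t * η)) * v ≤ ∫ x, Real.exp (-(t * ψ x)) ∂μ := by
    intro η hη
    have hset : ∀ t > 0, {x | Real.exp (-(t * η)) ≤ Real.exp (-(t * ψ x))} = {x | ψ x ≤ η} := by
      intro t ht
      ext x
      simp [ht]
    have hfin : μ {x | ψ x ≤ η} < ⊤ := by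
      have h1 : M ≤ max M 1 := le_max_left _ _
      have h2 : 0 < max M 1 := lt_max_of_lt_right one_pos
      rw [← hset _ h2]
      exact (hint _ h1).1.measure_ge_lt_top (Real.exp_pos _)
    refine ⟨μ.real {x | ψ x ≤ η}, ENNReal.toReal_pos (hpos η hη) hfin.ne, fun t ht htM => ?_⟩
    rw [← hset t ht]
    exact mul_meas_ge_le_integral_of_nonneg (Eventually.of_forall fun x => (Real.exp_pos _).le)
      (hint t htM).1 _
  refine ⟨hint, ?_, ?_⟩
  · obtain ⟨v, hv, hvZ⟩ := hlower 1 one_pos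
    filter_upwards [eventually_gt_atTop 0, eventually_ge_atTop M] with t ht htM
    exact lt_of_lt_of_le (by positivity) (hvZ t ht htM)
  rw [Metric.tendsto_nhds]
  intro γ hγ
  obtain ⟨η, hη, hsm⟩ := hsmall (γ / 3) (by positivity)
  obtain ⟨v, hv, hvZ⟩ := hlower (η / 2) (by positivity)
  set C := ∫ x, |g x| * Real.exp (-(M * ψ x)) ∂μ with hC
  have hlim : Tendsto (fun t : ℝ => Real.exp (-(t * (η / 2))) * (Real.exp (M * η) * C))
      atTop (𝓝 0) := by
    have : Tendsto (fun t : ℝ => Real.exp (-(t * (η / 2)))) atTop (𝓝 0) :=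
      Real.tendsto_exp_neg_atTop_nhds_zero.comp (tendsto_id.atTop_mul_const (by positivity))
    simpa using this.mul_const (Real.exp (M * η) * C)
  filter_upwards [eventually_gt_atTop 0, eventually_ge_atTop M,
    hlim.eventually_le_const (show 0 < γ / 3 * v by positivity)] with t ht htM hsmallt
  have hZ := hvZ t ht htM
  have hZpos : 0 < ∫ x, Real.exp (-(t * ψ x)) ∂μ := lt_of_lt_of_le (by positivity) hZ
  have hbound : |∫ x, g x * Real.exp (-(t * ψ x)) ∂μ| ≤
      γ / 3 * (∫ x, Real.exp (-(t * ψ x)) ∂μ) + Real.exp (-((t - M) * η)) * C := by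
    rw [hC, ← integral_const_mul, ← integral_const_mul, ← integral_add
      ((hint t htM).1.const_mul _) (hg.const_mul _)]
    rw [← Real.norm_eq_abs]
    refine norm_integral_le_of_norm_le (((hint t htM).1.const_mul _).add (hg.const_mul _)) ?_
    filter_upwards [hsm] with x hx
    rw [Real.norm_eq_abs, abs_mul, Real.abs_exp]
    rcases hx with hx | hx
    · have : 0 ≤ Real.exp (-((t - M) * η)) * (|g x| * Real.exp (-(M * ψ x))) := by positivity
      have := mul_le_mul_of_nonneg_right hx (Real.exp_pos (-(t * ψ x))).le
      linarith
    · have h1 : Real.exp (-(t * ψ x)) = Real.exp (-((t - M) * ψ x)) * Real.exp (-(M * ψ x)) := by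
        rw [← Real.exp_add]; ring_nf
      have h2 : Real.exp (-((t - M) * ψ x)) ≤ Real.exp (-((t - M) * η)) := by
        have := mul_le_mul_of_nonneg_left hx (sub_nonneg.2 htM)
        gcongr
      have h3 : 0 ≤ γ / 3 * Real.exp (-(t * ψ x)) := by positivity
      calc |g x| * Real.exp (-(t * ψ x))
          = Real.exp (-((t - M) * ψ x)) * (|g x| * Real.exp (-(M * ψ x))) := by rw [h1]; ring
        _ ≤ Real.exp (-((t - M) * η)) * (|g x| * Real.exp (-(M * ψ x))) := by gcongr
        _ ≤ _ := by linarith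
  have htail : Real.exp (-((t - M) * η)) * C ≤ γ / 3 * ∫ x, Real.exp (-(t * ψ x)) ∂μ := by
    have h1 : Real.exp (-((t - M) * η)) * C =
        Real.exp (-(t * (η / 2))) * (Real.exp (-(t * (η / 2))) * (Real.exp (M * η) * C)) := by
      rw [← mul_assoc, ← mul_assoc, ← Real.exp_add, ← Real.exp_add]; ring_nf
    rw [h1]
    calc _ ≤ Real.exp (-(t * (η / 2))) * (γ / 3 * v) := by gcongr
      _ = γ / 3 * (Real.exp (-(t * (η / 2))) * v) := by ring
      _ ≤ _ := by gcongr
  rw [Real.dist_eq, sub_zero, abs_div, abs_of_pos hZpos, div_lt_iff₀ hZpos]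
  nlinarith

/-- A set that is star-shaped about `c` at scale `r₀` and has positive measure at that scale has
positive measure near `c` at every scale. -/
theorem volume_inter_closedBall_ne_zero_of_locally_star {d : ℕ}
    {K : Set (EuclideanSpace ℝ (Fin d))} {c : EuclideanSpace ℝ (Fin d)} {r₀ r : ℝ}
    (hr₀ : 0 < r₀) (hr : 0 < r)
    (hvol : 0 < volume (K ∩ Metric.closedBall c r₀))
    (hstar : ∀ x ∈ K ∩ Metric.closedBall c r₀, ∀ α ∈ Set.Icc (0:ℝ) 1,
      α • x + (1 - α) • c ∈ K) :
    volume (K ∩ Metric.closedBall c r) ≠ 0 := by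
  set α := min 1 (r / r₀) with hα
  have hα0 : 0 < α := lt_min one_pos (by positivity)
  have hsub : AffineMap.homothety c α '' (K ∩ Metric.closedBall c r₀) ⊆
      K ∩ Metric.closedBall c r := by
    rintro _ ⟨x, hx, rfl⟩
    refine ⟨?_, ?_⟩
    · convert hstar x hx α ⟨hα0.le, min_le_left _ _⟩ using 1
      rw [AffineMap.homothety_apply, vsub_eq_sub, vadd_eq_add]
      module
    · have hxr := hx.2
      rw [Metric.mem_closedBall, dist_eq_norm] at hxr ⊢
      rw [AffineMap.homothety_apply, vsub_eq_sub, vadd_eq_add, add_sub_cancel_right, norm_smul,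
        Real.norm_of_nonneg hα0.le]
      calc α * ‖x - c‖ ≤ r / r₀ * r₀ := by gcongr; exact min_le_right _ _
        _ = r := by field_simp
  refine fun h0 => ?_
  have himage := measure_mono_null hsub h0
  rw [Measure.addHaar_image_homothety] at himage
  rcases mul_eq_zero.1 himage with h1 | h1
  · have : 0 < |α ^ Module.finrank ℝ (EuclideanSpace ℝ (Fin d))| := by positivity
    exact (ENNReal.ofReal_pos.2 this).ne' h1
  · exact hvol.ne' h1

/-- If some sublevel set of `φ` above its strict minimum is bounded, `φ` is bounded away from the
minimum outside every ball around the minimizer. -/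
theorem exists_gap_off_ball {X : Type*} [MetricSpace X] [ProperSpace X] {K : Set X}
    (hK : IsClosed K) {φ : X → ℝ} (hφ : ContinuousOn φ K) {c : X}
    (hmin : ∀ x ∈ K, x ≠ c → φ c < φ x) {ε : ℝ} (hε : 0 < ε)
    (hbdd : Bornology.IsBounded {x ∈ K | φ x ≤ φ c + ε}) {r : ℝ} (hr : 0 < r) :
    ∃ η > 0, ∀ x ∈ K, r ≤ dist x c → η ≤ φ x - φ c := by
  have hclosed : IsClosed {x ∈ K | φ x ≤ φ c + ε} :=
    hφ.preimage_isClosed_of_isClosed hK isClosed_Iic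
  have hcpt : IsCompact ({x ∈ K | φ x ≤ φ c + ε} ∩ {x | r ≤ dist x c}) :=
    (Metric.isCompact_of_isClosed_isBounded hclosed hbdd).inter_right
      (isClosed_le continuous_const (continuous_id.dist continuous_const))
  rcases Set.eq_empty_or_nonempty ({x ∈ K | φ x ≤ φ c + ε} ∩ {x | r ≤ dist x c}) with he | hne
  · refine ⟨ε, hε, fun x hx hxr => ?_⟩
    by_contra hlt
    have : x ∈ {x ∈ K | φ x ≤ φ c + ε} ∩ {x | r ≤ dist x c} := ⟨⟨hx, by linarith⟩, hxr⟩
    simp [he] at this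
  · obtain ⟨y, hy, hymin⟩ := hcpt.exists_isMinOn hne (hφ.mono fun x hx => hx.1.1)
    have hyc : y ≠ c := by
      rintro rfl
      have : r ≤ dist y y := hy.2
      rw [dist_self] at this
      linarith
    refine ⟨min ε (φ y - φ c), lt_min hε (sub_pos.2 (hmin y hy.1.1 hyc)), fun x hx hxr => ?_⟩
    rcases le_total (φ x) (φ c + ε) with hle | hle
    · have hxy : φ y ≤ φ x := hymin ⟨⟨hx, hle⟩, hxr⟩
      exact (min_le_right _ _).trans (by linarith)
    · exact (min_le_left _ _).trans (by linarith)

/-- Self-normalized Laplace approximation with the minimizer on the boundary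
(Theorem 3 of the paper). -/
theorem laplace_self_normalized_boundary {d : ℕ}
    (K : Set (EuclideanSpace ℝ (Fin d))) (hKclosed : IsClosed K)
    (φ h : EuclideanSpace ℝ (Fin d) → ℝ)
    (hφ : ContinuousOn φ K)
    (xs : EuclideanSpace ℝ (Fin d))
    (hxsK : xs ∈ K) (hxsbdry : xs ∈ frontier K)
    (hmin : ∀ x ∈ K, x ≠ xs → φ xs < φ x)
    (ε : ℝ) (hε : 0 < ε)
    (hbdd : Bornology.IsBounded {x ∈ K | φ x ≤ φ xs + ε})
    (hintε : IntegrableOn (fun x => Real.exp (-φ x / ε)) K)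
    (a q : ℝ) (ha : 0 < a) (hq : 0 < q)
    (U : Set (EuclideanSpace ℝ (Fin d))) (hU : U ∈ 𝓝 xs)
    (hholder : ∀ x ∈ K ∩ U, φ x - φ xs ≤ a * ‖x - xs‖ ^ q)
    (r₀ : ℝ) (hr₀ : 0 < r₀)
    (hvol : 0 < volume (K ∩ Metric.closedBall xs r₀))
    (hstar : ∀ x ∈ K ∩ Metric.closedBall xs r₀, ∀ α ∈ Set.Icc (0:ℝ) 1,
      α • x + (1 - α) • xs ∈ K)
    (hh : ContinuousOn h K)
    (hint : IntegrableOn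
      (fun x => |h x| * Real.exp (-(d : ℝ) * φ x / (q * ε))) K) :
    Tendsto (fun δ : ℝ =>
      (∫ x in K, h x * Real.exp (-φ x / δ)) / (∫ x in K, Real.exp (-φ x / δ)))
      (𝓝[>] 0) (𝓝 (h xs)) := by
  have hKm := hKclosed.measurableSet
  have hψ : ∀ x ∈ K, 0 ≤ φ x - φ xs := fun x hx => by
    rcases eq_or_ne x xs with rfl | hne
    · simp
    · exact sub_nonneg.2 (hmin x hx hne).le
  have hψae : ∀ᵐ x ∂(volume.restrict K), 0 ≤ φ x - φ xs :=
    (ae_restrict_mem hKm).mono hψ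
  have hψc : ContinuousOn (fun x => φ x - φ xs) K := hφ.sub continuousOn_const
  have hgc : ContinuousOn (fun x => h x - h xs) K := hh.sub continuousOn_const
  have hψm : AEStronglyMeasurable (fun x => φ x - φ xs) (volume.restrict K) :=
    hψc.aestronglyMeasurable hKm
  have hgm : AEStronglyMeasurable (fun x => h x - h xs) (volume.restrict K) :=
    hgc.aestronglyMeasurable hKm
  set s : ℝ := d / (q * ε) with hs
  have hs0 : 0 ≤ s := by positivity
  set M : ℝ := 1 / ε + s with hM
  have hεinv : 0 < 1 / ε := by positivity
  have hmM : AEStronglyMeasurable (fun x => Real.exp (-(M * (φ x - φ xs))))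
      (volume.restrict K) :=
    Real.continuous_exp.comp_aestronglyMeasurable (hψm.const_mul M).neg
  have hexp : Integrable (fun x => Real.exp (-(M * (φ x - φ xs)))) (volume.restrict K) := by
    refine (hintε.const_mul (Real.exp (φ xs / ε))).mono' hmM ?_
    filter_upwards [hψae] with x hx
    rw [Real.norm_eq_abs, Real.abs_exp, ← Real.exp_add, Real.exp_le_exp]
    have : φ xs / ε + -φ x / ε = -(1 / ε * (φ x - φ xs)) := by ring
    rw [this, hM]
    nlinarith [mul_nonneg hs0 hx]
  have hg : Integrable (fun x => |h x - h xs| * Real.exp (-(M * (φ x - φ xs))))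
      (volume.restrict K) := by
    refine ((hint.const_mul (Real.exp (s * φ xs))).add (hexp.const_mul |h xs|)).mono'
      (hgm.norm.mul hmM) ?_
    filter_upwards [hψae] with x hx
    rw [Real.norm_eq_abs, abs_mul, abs_abs, Real.abs_exp]
    have h1 : Real.exp (-(M * (φ x - φ xs))) ≤
        Real.exp (s * φ xs) * Real.exp (-(d : ℝ) * φ x / (q * ε)) := by
      rw [← Real.exp_add, Real.exp_le_exp]
      have : s * φ xs + -(d : ℝ) * φ x / (q * ε) = -(s * (φ x - φ xs)) := by rw [hs]; ring
      rw [this, hM]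
      nlinarith [mul_nonneg hεinv.le hx]
    calc |h x - h xs| * Real.exp (-(M * (φ x - φ xs)))
        ≤ (|h x| + |h xs|) * Real.exp (-(M * (φ x - φ xs))) := by gcongr; exact abs_sub _ _
      _ = |h x| * Real.exp (-(M * (φ x - φ xs))) + |h xs| * Real.exp (-(M * (φ x - φ xs))) := by
        ring
      _ ≤ |h x| * (Real.exp (s * φ xs) * Real.exp (-(d : ℝ) * φ x / (q * ε))) +
          |h xs| * Real.exp (-(M * (φ x - φ xs))) := by gcongr
      _ = _ := by simp only [Pi.add_apply]; ring
  have hpos : ∀ η > 0, (volume.restrict K) {x | φ x - φ xs ≤ η} ≠ 0 := by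
    intro η hη h0
    obtain ⟨r, hr, hball⟩ := Metric.continuousWithinAt_iff.1 (hφ xs hxsK) η hη
    refine volume_inter_closedBall_ne_zero_of_locally_star hr₀ (half_pos hr) hvol hstar ?_
    refine measure_mono_null ?_ (le_antisymm ((Measure.le_restrict_apply _ _).trans h0.le) bot_le)
    rintro x ⟨hxK, hxr⟩
    have hlt := hball hxK (lt_of_le_of_lt hxr (half_lt_self hr))
    rw [Real.dist_eq] at hlt
    exact ⟨(le_abs_self _).trans hlt.le, hxK⟩
  have hsmall : ∀ γ > 0, ∃ η > 0, ∀ᵐ x ∂(volume.restrict K),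
      |h x - h xs| ≤ γ ∨ η ≤ φ x - φ xs := by
    intro γ hγ
    obtain ⟨r, hr, hball⟩ := Metric.continuousWithinAt_iff.1 (hh xs hxsK) γ hγ
    obtain ⟨η, hη, hgap⟩ := exists_gap_off_ball hKclosed hφ hmin hε hbdd hr
    refine ⟨η, hη, (ae_restrict_mem hKm).mono fun x hx => ?_⟩
    rcases lt_or_ge (dist x xs) r with hlt | hge
    · exact Or.inl (hball hx hlt).le
    · exact Or.inr (hgap x hx hge)
  obtain ⟨hI, hZ, hlim⟩ := tendsto_gibbs_average_zero hψm hgm hψae hexp hg hpos hsmall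
  have hlim' : Tendsto (fun t : ℝ =>
      (∫ x in K, h x * Real.exp (-(t * φ x))) / (∫ x in K, Real.exp (-(t * φ x))))
      atTop (𝓝 (h xs)) := by
    rw [← zero_add (h xs)]
    refine (hlim.add_const (h xs)).congr' ?_
    filter_upwards [hZ, eventually_ge_atTop M] with t hZt htM
    obtain ⟨hI1, hI2⟩ := hI t htM
    have hshift : ∀ x, Real.exp (-(t * φ x)) =
        Real.exp (-(t * φ xs)) * Real.exp (-(t * (φ x - φ xs))) := fun x => by
      rw [← Real.exp_add]; ring_nf
    have hden : ∫ x in K, Real.exp (-(t * φ x)) =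
        Real.exp (-(t * φ xs)) * ∫ x in K, Real.exp (-(t * (φ x - φ xs))) := by
      rw [← integral_const_mul]
      simp_rw [← hshift]
    have hnum : ∫ x in K, h x * Real.exp (-(t * φ x)) =
        Real.exp (-(t * φ xs)) * ((∫ x in K, (h x - h xs) * Real.exp (-(t * (φ x - φ xs)))) +
          h xs * ∫ x in K, Real.exp (-(t * (φ x - φ xs)))) := by
      rw [← integral_const_mul, ← integral_add hI2 (hI1.const_mul _), ← integral_const_mul]
      congr 1
      ext x
      rw [hshift]
      ring
    rw [hden, hnum, mul_div_mul_left _ _ (Real.exp_pos _).ne', add_div,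
      mul_div_cancel_right₀ _ hZt.ne']
  refine (hlim'.comp tendsto_inv_nhdsGT_zero).congr fun δ => ?_
  simp only [Function.comp_apply, div_eq_inv_mul, mul_neg]
end

section
/- Let K ⊆ ℝ^d be a closed set and x ∈ ℝ^d a point with a unique Euclidean projection y_x = P_K(x) onto K (the unique minimizer of y ↦ ‖x − y‖₂² over K). Assume there exists r₀ > 0 such that K ∩ B(y_x, r₀) has positive Lebesgue measure and K is locally star-shaped about y_x at scale r₀: for every y ∈ K ∩ B(y_x, r₀) and every α ∈ [0,1], the point αy + (1−α)y_x lies in K. Then for any continuous h : ℝ^d → ℝ with ∫_K |h(y)| exp(−d·‖x − y‖₂²/2) dy < ∞, the ratio (∫_K h(y) exp(−‖x − y‖₂²/δ) dy) / (∫_K exp(−‖x − y‖₂²/δ) dy) converges to h(y_x) as δ → 0⁺. -/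
open MeasureTheory Real Filter Set Topology Metric

/-- A set that is star-shaped about `p` at scale `r₀`, and has positive measure at that scale, has
positive measure at every scale. -/
theorem measure_ball_inter_pos_of_starShaped {E : Type*} [NormedAddCommGroup E]
    [NormedSpace ℝ E] [FiniteDimensional ℝ E] [MeasurableSpace E] [BorelSpace E]
    (μ : Measure E) [μ.IsAddHaarMeasure] {K : Set E} {p : E} {r₀ : ℝ} (hr₀ : 0 < r₀)
    (hvol : 0 < μ (K ∩ closedBall p r₀))
    (hstar : ∀ y ∈ K ∩ closedBall p r₀, ∀ α ∈ Icc (0 : ℝ) 1, α • y + (1 - α) • p ∈ K)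
    {ε : ℝ} (hε : 0 < ε) : 0 < μ (ball p ε ∩ K) := by
  obtain ⟨α, hα₀, hα⟩ : ∃ α, 0 < α ∧ α < min 1 (ε / r₀) := exists_between (by positivity)
  have hα₁ : α < 1 := hα.trans_le (min_le_left _ _)
  have hαε : α * r₀ < ε := (lt_div_iff₀ hr₀).1 (hα.trans_le (min_le_right _ _))
  have hsub : AffineMap.homothety p α '' (K ∩ closedBall p r₀) ⊆ ball p ε ∩ K := by
    rintro _ ⟨y, hy, rfl⟩
    constructor
    · rw [mem_ball, dist_homothety_center, Real.norm_of_nonneg hα₀.le, dist_comm]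
      exact (mul_le_mul_of_nonneg_left (mem_closedBall.1 hy.2) hα₀.le).trans_lt hαε
    · rw [AffineMap.homothety_eq_lineMap, AffineMap.lineMap_apply_module, add_comm]
      exact hstar y hy α ⟨hα₀.le, hα₁.le⟩
  refine lt_of_lt_of_le ?_ (measure_mono hsub)
  rw [Measure.addHaar_image_homothety]
  exact ENNReal.mul_pos (ENNReal.ofReal_pos.2 (by positivity)).ne' hvol.ne'

/-- Laplace's principle on a closed set, normalized by the mass near the minimizer `x₀`. -/
theorem tendsto_setIntegral_exp_neg_mul_div {α : Type*} [MetricSpace α] [ProperSpace α]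
    [MeasurableSpace α] [BorelSpace α] {μ : Measure α} [IsLocallyFiniteMeasure μ]
    {K : Set α} (hK : IsClosed K) {x₀ : α} {f : α → ℝ} (hf : Continuous f)
    (hsep : ∀ u, IsOpen u → x₀ ∈ u → ∃ c, f x₀ < c ∧ ∀ y ∈ K \ u, c ≤ f y)
    (hμ : ∀ u, IsOpen u → x₀ ∈ u → 0 < μ (u ∩ K))
    {g : α → ℝ} (hg : IntegrableOn g K μ) (hgc : ContinuousAt g x₀) :
    Tendsto (fun s : ℝ => (∫ y in K, exp (-(s * f y)) * g y ∂μ) /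
      ∫ y in K ∩ closedBall x₀ 1, exp (-(s * f y)) ∂μ) atTop (𝓝 (g x₀)) := by
  set t := K ∩ closedBall x₀ 1
  have ht : IsCompact t := (isCompact_closedBall x₀ 1).inter_left hK
  have hI (s : ℝ) : IntegrableOn (fun y => exp (-(s * f y))) t μ :=
    (by fun_prop : Continuous fun y => exp (-(s * f y))).continuousOn.integrableOn_compact ht
  have hlower {c : ℝ} (hc : f x₀ < c) : ∃ v : ℝ, 0 < v ∧ ∀ s : ℝ, 0 ≤ s →
      v * exp (-(s * c)) ≤ ∫ y in t, exp (-(s * f y)) ∂μ := by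
    set w := f ⁻¹' Iio c ∩ ball x₀ 1
    have hwo : IsOpen w := (isOpen_Iio.preimage hf).inter isOpen_ball
    have hwt : w ∩ K ⊆ t := fun y hy => ⟨hy.2, ball_subset_closedBall hy.1.2⟩
    have hfin : μ (w ∩ K) ≠ ⊤ := ((measure_mono hwt).trans_lt ht.measure_lt_top).ne
    refine ⟨μ.real (w ∩ K), ENNReal.toReal_pos
      (hμ w hwo ⟨hc, mem_ball_self one_pos⟩).ne' hfin, fun s hs => ?_⟩
    calc μ.real (w ∩ K) * exp (-(s * c)) = ∫ _ in w ∩ K, exp (-(s * c)) ∂μ := by simp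
      _ ≤ ∫ y in w ∩ K, exp (-(s * f y)) ∂μ := by
        refine setIntegral_mono_on (integrableOn_const hfin) ((hI s).mono_set hwt)
          (hwo.measurableSet.inter hK.measurableSet) fun y hy => ?_
        have : f y ≤ c := le_of_lt hy.1.1
        gcongr
      _ ≤ ∫ y in t, exp (-(s * f y)) ∂μ :=
        setIntegral_mono_set (hI s) (Eventually.of_forall fun y => (exp_pos _).le)
          (Eventually.of_forall hwt)
  have hpos : ∀ s : ℝ, 0 ≤ s → 0 < ∫ y in t, exp (-(s * f y)) ∂μ := by
    obtain ⟨v, hv, h⟩ := hlower (lt_add_one (f x₀))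
    exact fun s hs => (by positivity : 0 < v * exp (-(s * (f x₀ + 1)))).trans_le (h s hs)
  have key := tendsto_setIntegral_peak_smul_of_integrableOn_of_tendsto (μ := μ) (l := atTop)
    (φ := fun s y => exp (-(s * f y)) / ∫ z in t, exp (-(s * f z)) ∂μ)
    hK.measurableSet ht.measurableSet inter_subset_left
    (inter_mem_nhdsWithin K (closedBall_mem_nhds x₀ one_pos)) ht.measure_lt_top.ne
    ?_ ?_ ?_ ?_ hg (hgc.tendsto.mono_left nhdsWithin_le_nhds)
  · refine key.congr fun s => ?_
    simp_rw [smul_eq_mul, div_mul_eq_mul_div]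
    rw [integral_div]
  · filter_upwards [eventually_ge_atTop 0] with s hs y _
    exact div_nonneg (exp_pos _).le (hpos s hs).le
  · intro u hu hxu
    obtain ⟨c, hc, hcf⟩ := hsep u hu hxu
    obtain ⟨c', hc', hcc'⟩ := exists_between hc
    obtain ⟨v, hv, hvZ⟩ := hlower hc'
    have hlim : Tendsto (fun s : ℝ => v⁻¹ * exp (-(s * (c - c')))) atTop (𝓝 0) := by
      rw [← mul_zero v⁻¹]
      exact (tendsto_exp_neg_atTop_nhds_zero.comp
        (tendsto_id.atTop_mul_const (sub_pos.2 hcc'))).const_mul _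
    refine tendstoUniformlyOn_iff.2 fun ε hε => ?_
    filter_upwards [(tendsto_order.1 hlim).2 ε hε, eventually_ge_atTop 0] with s hs hs₀ y hy
    rw [Pi.zero_apply, dist_zero_left,
      Real.norm_of_nonneg (div_nonneg (exp_pos _).le (hpos s hs₀).le)]
    refine lt_of_le_of_lt ?_ hs
    have hcy := hcf y hy
    calc exp (-(s * f y)) / ∫ z in t, exp (-(s * f z)) ∂μ
        ≤ exp (-(s * c)) / (v * exp (-(s * c'))) := by
          gcongr
          exact hvZ s hs₀
      _ = v⁻¹ * exp (-(s * (c - c'))) := by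
          rw [show -(s * (c - c')) = -(s * c) - -(s * c') by ring, exp_sub]
          field_simp
  · refine tendsto_const_nhds.congr' ?_
    filter_upwards [eventually_ge_atTop 0] with s hs
    rw [integral_div, div_self (hpos s hs).ne']
  · exact Eventually.of_forall fun s => Continuous.aestronglyMeasurable (by fun_prop)

/-- A unique nearest point of a closed set is well separated from the rest of the set. -/
theorem exists_lt_norm_sub_sq_of_isClosed {E : Type*} [NormedAddCommGroup E] [ProperSpace E]
    {K : Set E} (hK : IsClosed K) {x p : E}
    (hp : ∀ y ∈ K, y ≠ p → ‖x - p‖ ^ 2 < ‖x - y‖ ^ 2) {u : Set E} (hu : IsOpen u) (hpu : p ∈ u) :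
    ∃ c, ‖x - p‖ ^ 2 < c ∧ ∀ y ∈ K \ u, c ≤ ‖x - y‖ ^ 2 := by
  rcases eq_empty_or_nonempty (K \ u) with h | h
  · exact ⟨‖x - p‖ ^ 2 + 1, lt_add_one _, by simp [h]⟩
  obtain ⟨z, hz, hzx⟩ := (hK.sdiff hu).exists_infDist_eq_dist h x
  refine ⟨‖x - z‖ ^ 2, hp z hz.1 fun hzp => hz.2 (hzp ▸ hpu), fun y hy => ?_⟩
  gcongr
  rw [← dist_eq_norm, ← dist_eq_norm, ← hzx]
  exact infDist_le_dist_of_mem hy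

/-- The Gaussian weight `exp (-d ‖x - y‖² / 2)` is integrable on `ℝ^d`, including for `d = 0`. -/
theorem integrable_exp_neg_dim_mul_norm_sub_sq {d : ℕ} (x : EuclideanSpace ℝ (Fin d)) :
    Integrable fun y : EuclideanSpace ℝ (Fin d) => exp (-(d : ℝ) * ‖x - y‖ ^ 2 / 2) := by
  rcases Nat.eq_zero_or_pos d with rfl | hd
  · exact (by fun_prop : Continuous _).integrable_of_hasCompactSupport
      (HasCompactSupport.of_compactSpace _)
  have hd' : (0 : ℝ) < d := by exact_mod_cast hd
  have hgauss : Integrable fun v : EuclideanSpace ℝ (Fin d) => exp (-((d : ℝ) / 2) * ‖v‖ ^ 2) :=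
    .of_integral_ne_zero (by
      rw [GaussianFourier.integral_rexp_neg_mul_sq_norm (by positivity)]
      positivity)
  refine (hgauss.comp_sub_left x).congr (Eventually.of_forall fun y => ?_)
  dsimp only
  ring_nf

/-- Self-normalized Laplace approximation of the projection onto a closed set
(Corollary 2, general `h`). -/
theorem laplace_projection {d : ℕ}
    (K : Set (EuclideanSpace ℝ (Fin d))) (hKclosed : IsClosed K)
    (x yx : EuclideanSpace ℝ (Fin d))
    (hyxK : yx ∈ K)
    (hproj : ∀ y ∈ K, y ≠ yx → ‖x - yx‖ ^ 2 < ‖x - y‖ ^ 2)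
    (r₀ : ℝ) (hr₀ : 0 < r₀)
    (hvol : 0 < volume (K ∩ Metric.closedBall yx r₀))
    (hstar : ∀ y ∈ K ∩ Metric.closedBall yx r₀, ∀ α ∈ Set.Icc (0:ℝ) 1,
      α • y + (1 - α) • yx ∈ K)
    (h : EuclideanSpace ℝ (Fin d) → ℝ) (hh : Continuous h)
    (hint : IntegrableOn
      (fun y => |h y| * Real.exp (-(d : ℝ) * ‖x - y‖ ^ 2 / 2)) K) :
    Tendsto (fun δ : ℝ =>
      (∫ y in K, h y * Real.exp (-‖x - y‖ ^ 2 / δ)) /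
        (∫ y in K, Real.exp (-‖x - y‖ ^ 2 / δ)))
      (𝓝[>] 0) (𝓝 (h yx)) := by
  set w : EuclideanSpace ℝ (Fin d) → ℝ := fun y => exp (-(d : ℝ) * ‖x - y‖ ^ 2 / 2) with hw
  have hwc : Continuous w := by fun_prop
  have hwi : IntegrableOn w K := (integrable_exp_neg_dim_mul_norm_sub_sq x).integrableOn
  have hhw : IntegrableOn (fun y => h y * w y) K :=
    Integrable.mono hint (hh.mul hwc).aestronglyMeasurable
      (Eventually.of_forall fun y => by simp [hw])
  have hmass (u : Set (EuclideanSpace ℝ (Fin d))) (hu : IsOpen u) (hyu : yx ∈ u) :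
      0 < volume (u ∩ K) := by
    obtain ⟨ε, hε, hεu⟩ := Metric.isOpen_iff.1 hu yx hyu
    exact (measure_ball_inter_pos_of_starShaped volume hr₀ hvol hstar hε).trans_le
      (measure_mono (inter_subset_inter_left K hεu))
  have hlaplace {g : EuclideanSpace ℝ (Fin d) → ℝ} (hg : IntegrableOn g K) (hgc : Continuous g) :=
    tendsto_setIntegral_exp_neg_mul_div hKclosed (f := fun y => ‖x - y‖ ^ 2) (by fun_prop)
      (fun u hu hyu => exists_lt_norm_sub_sq_of_isClosed hKclosed hproj hu hyu) hmass
      hg hgc.continuousAt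
  have hs : Tendsto (fun δ : ℝ => δ⁻¹ - d / 2) (𝓝[>] 0) atTop :=
    tendsto_atTop_add_const_right _ _ tendsto_inv_nhdsGT_zero
  have hsplit (δ : ℝ) (y : EuclideanSpace ℝ (Fin d)) :
      exp (-((δ⁻¹ - d / 2) * ‖x - y‖ ^ 2)) * w y = exp (-‖x - y‖ ^ 2 / δ) := by
    rw [hw, ← exp_add]
    ring_nf
  have hquot := ((hlaplace hhw (hh.mul hwc)).div (hlaplace hwi hwc) (exp_pos _).ne').comp hs
  rw [mul_div_cancel_right₀ _ (exp_pos _).ne'] at hquot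
  refine hquot.congr' ?_
  have hZ := ((hlaplace hwi hwc).comp hs).eventually_ne (exp_pos _).ne'
  filter_upwards [hZ] with δ hδ
  simp only [Function.comp_apply, Pi.div_apply, mul_left_comm _ (h _), hsplit] at hδ ⊢
  exact div_div_div_cancel_right₀ (fun h0 => hδ (by rw [h0, div_zero])) _ _
end

section
/- Let K ⊆ ℝ^d be a closed set and x ∈ ℝ^d a point with a unique Euclidean projection y_x = P_K(x) onto K (the unique minimizer of y ↦ ‖x − y‖₂² over K). Assume there exists r₀ > 0 such that K ∩ B(y_x, r₀) has positive Lebesgue measure and K is locally star-shaped about y_x at scale r₀: for every y ∈ K ∩ B(y_x, r₀) and every α ∈ [0,1], the point αy + (1−α)y_x lies in K. If ∫_K ‖y‖_∞ exp(−d·‖x − y‖₂²/2) dy < ∞, then the vector P_K^δ(x) = (∫_K y exp(−‖x − y‖₂²/(2δ)) dy) / (∫_K exp(−‖x − y‖₂²/(2δ)) dy), defined coordinatewise, converges to P_K(x) as δ → 0⁺. -/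
open MeasureTheory Real Filter Set Topology Metric

/-- A set of positive measure that is star-shaped about `p` at some scale has positive measure in
every ball around `p`. -/
theorem measure_inter_closedBall_pos_of_star {E : Type*} [NormedAddCommGroup E] [NormedSpace ℝ E]
    [FiniteDimensional ℝ E] [MeasurableSpace E] [BorelSpace E] (μ : Measure E) [μ.IsAddHaarMeasure]
    {K : Set E} {p : E} {r₀ : ℝ} (hr₀ : 0 < r₀)
    (hvol : 0 < μ (K ∩ closedBall p r₀))
    (hstar : ∀ y ∈ K ∩ closedBall p r₀, ∀ α ∈ Icc (0 : ℝ) 1, α • y + (1 - α) • p ∈ K)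
    {r : ℝ} (hr : 0 < r) : 0 < μ (K ∩ closedBall p r) := by
  set α : ℝ := min 1 (r / r₀)
  have hα : 0 < α := lt_min one_pos (div_pos hr hr₀)
  have hα_mul : α * r₀ ≤ r := by
    calc α * r₀ ≤ r / r₀ * r₀ := by gcongr; exact min_le_right _ _
      _ = r := div_mul_cancel₀ _ hr₀.ne'
  have himage : 0 < μ (AffineMap.homothety p α '' (K ∩ closedBall p r₀)) := by
    rw [Measure.addHaar_image_homothety]
    exact ENNReal.mul_pos (by simp [hα.ne']) hvol.ne'
  refine himage.trans_le (measure_mono ?_)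
  rintro _ ⟨y, hy, rfl⟩
  refine ⟨?_, ?_⟩
  · convert hstar y hy α ⟨hα.le, min_le_left _ _⟩ using 1
    simp only [AffineMap.homothety_apply, vsub_eq_sub, vadd_eq_add]
    module
  · rw [mem_closedBall, dist_homothety_center, Real.norm_of_nonneg hα.le, dist_comm]
    exact (mul_le_mul_of_nonneg_left hy.2 hα.le).trans hα_mul

/-- A continuous function with a well-separated minimum on `K` at `p`, where `p` is charged by
`μ` in `K`, has Gibbs weights, normalized on the unit ball around `p`, that concentrate at `p`. -/
theorem tendsto_setIntegral_exp_neg_mul_div_of_unique_minimum {E : Type*} [MetricSpace E]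
    [ProperSpace E] [MeasurableSpace E] [BorelSpace E]
    {μ : Measure E} [IsLocallyFiniteMeasure μ] {K : Set E} (hK : IsClosed K) {p : E}
    (hpos : ∀ r : ℝ, 0 < r → 0 < μ (K ∩ closedBall p r)) {f : E → ℝ} (hf : Continuous f)
    (hmin : ∀ u : Set E, IsOpen u → p ∈ u → ∃ m, f p < m ∧ ∀ y ∈ K \ u, m ≤ f y)
    {g : E → ℝ} (hg : IntegrableOn g K μ) (hgp : ContinuousAt g p) :
    Tendsto (fun c : ℝ => ∫ y in K, Real.exp (-(c * f y)) /
      (∫ z in K ∩ closedBall p 1, Real.exp (-(c * f z)) ∂μ) * g y ∂μ) atTop (𝓝 (g p)) := by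
  have hcompact : ∀ r : ℝ, IsCompact (K ∩ closedBall p r) := fun r =>
    (isCompact_closedBall p r).inter_left hK
  have hexp : ∀ c : ℝ, Continuous fun y => Real.exp (-(c * f y)) := fun c => by fun_prop
  have hint : ∀ c r : ℝ, IntegrableOn (fun y => Real.exp (-(c * f y))) (K ∩ closedBall p r) μ :=
    fun c r => (hexp c).continuousOn.integrableOn_compact (hcompact r)
  have hreal : ∀ r : ℝ, 0 < r → 0 < μ.real (K ∩ closedBall p r) := fun r hr =>
    ENNReal.toReal_pos (hpos r hr).ne' (hcompact r).measure_lt_top.ne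
  have hlower : ∀ b : ℝ, f p < b → ∃ V : ℝ, 0 < V ∧ ∀ c : ℝ, 0 ≤ c →
      Real.exp (-(c * b)) * V ≤ ∫ z in K ∩ closedBall p 1, Real.exp (-(c * f z)) ∂μ := by
    intro b hb
    obtain ⟨r, hr, hrb⟩ := Metric.nhds_basis_closedBall.mem_iff.1
      (hf.continuousAt.eventually_lt continuousAt_const hb)
    refine ⟨μ.real (K ∩ closedBall p (min r 1)), hreal _ (lt_min hr one_pos), fun c hc => ?_⟩
    refine (setIntegral_ge_of_const_le_real (hcompact _).measurableSet
      (hcompact _).measure_lt_top.ne (fun y hy => ?_) (hint c _)).trans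
      (setIntegral_mono_set (hint c 1) (ae_of_all _ fun y => (Real.exp_pos _).le)
        (inter_subset_inter_right K (closedBall_subset_closedBall (min_le_right _ _))).eventuallyLE)
    have hyb : f y < b := hrb (closedBall_subset_closedBall (min_le_left _ _) hy.2)
    gcongr
  have hZ : ∀ c : ℝ, 0 ≤ c →
      0 < ∫ z in K ∩ closedBall p 1, Real.exp (-(c * f z)) ∂μ := fun c hc => by
    obtain ⟨V, hV, h⟩ := hlower (f p + 1) (lt_add_one _)
    exact (mul_pos (Real.exp_pos _) hV).trans_le (h c hc)
  refine tendsto_setIntegral_peak_smul_of_integrableOn_of_tendsto hK.measurableSet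
    (hcompact 1).measurableSet inter_subset_left
    (inter_mem self_mem_nhdsWithin (mem_nhdsWithin_of_mem_nhds (closedBall_mem_nhds p one_pos)))
    (hcompact 1).measure_lt_top.ne ?_ ?_ ?_ ?_ hg (hgp.tendsto.mono_left nhdsWithin_le_nhds)
  · filter_upwards [eventually_ge_atTop 0] with c hc y _
    exact div_nonneg (Real.exp_pos _).le (hZ c hc).le
  · intro u hu hpu
    obtain ⟨m, hm, hmK⟩ := hmin u hu hpu
    obtain ⟨b, hpb, hbm⟩ := exists_between hm
    obtain ⟨V, hV, hVZ⟩ := hlower b hpb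
    have hdecay : Tendsto (fun c : ℝ => Real.exp (-(c * (m - b))) / V) atTop (𝓝 0) := by
      have := (Real.tendsto_exp_neg_atTop_nhds_zero.comp
        (tendsto_id.atTop_mul_const (sub_pos.2 hbm))).div_const V
      simpa using this
    rw [Metric.tendstoUniformlyOn_iff]
    intro ε hε
    filter_upwards [eventually_ge_atTop 0, hdecay.eventually_lt_const hε] with c hc hcε y hy
    rw [Pi.zero_apply, dist_zero_left,
      Real.norm_of_nonneg (div_nonneg (Real.exp_pos _).le (hZ c hc).le)]
    refine lt_of_le_of_lt ?_ hcε
    calc Real.exp (-(c * f y)) / (∫ z in K ∩ closedBall p 1, Real.exp (-(c * f z)) ∂μ)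
        ≤ Real.exp (-(c * m)) / (Real.exp (-(c * b)) * V) := by
          have := hmK y hy
          have := hVZ c hc
          gcongr
      _ = Real.exp (-(c * (m - b))) / V := by
          rw [← div_div, ← Real.exp_sub]
          ring_nf
  · refine tendsto_const_nhds.congr' ?_
    filter_upwards [eventually_ge_atTop 0] with c hc
    rw [integral_div, div_self (hZ c hc).ne']
  · exact Eventually.of_forall fun c =>
      ((hexp c).div_const _).aestronglyMeasurable

/-- The Gaussian centred at any point of a Euclidean space is integrable. -/
theorem integrable_exp_neg_mul_sq_norm_sub {V : Type*} [NormedAddCommGroup V]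
    [InnerProductSpace ℝ V] [FiniteDimensional ℝ V] [MeasurableSpace V] [BorelSpace V]
    {b : ℝ} (hb : 0 < b) (x : V) : Integrable fun y : V => Real.exp (-(b * ‖x - y‖ ^ 2)) := by
  have h := (GaussianFourier.integrable_cexp_neg_mul_sq_norm_add (b := (b : ℂ)) (by simpa) 0
    (0 : V)).norm
  simp only [zero_mul, add_zero, Complex.norm_exp] at h
  convert h.comp_sub_left x using 3 with y
  norm_cast
  ring

/-- A unique nearest point of a closed set is a well-separated minimum of the distance. -/
theorem exists_lt_half_sq_norm_sub_of_unique_projection {E : Type*} [NormedAddCommGroup E]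
    [ProperSpace E] {K : Set E} (hK : IsClosed K) {x p : E}
    (hproj : ∀ y ∈ K, y ≠ p → ‖x - p‖ ^ 2 < ‖x - y‖ ^ 2) {u : Set E} (hu : IsOpen u)
    (hpu : p ∈ u) : ∃ m, ‖x - p‖ ^ 2 / 2 < m ∧ ∀ y ∈ K \ u, m ≤ ‖x - y‖ ^ 2 / 2 := by
  rcases (K \ u).eq_empty_or_nonempty with hempty | hne
  · exact ⟨_, lt_add_one _, by simp [hempty]⟩
  · obtain ⟨z, hz, hzx⟩ := (hK.sdiff hu).exists_infDist_eq_dist hne x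
    refine ⟨‖x - z‖ ^ 2 / 2, ?_, fun y hy => ?_⟩
    · have := hproj z hz.1 fun h => hz.2 (h ▸ hpu)
      linarith
    · have : ‖x - z‖ ≤ ‖x - y‖ := by
        rw [← dist_eq_norm, ← dist_eq_norm, ← hzx]
        exact infDist_le_dist_of_mem hy
      gcongr

/-- The smoothed projection `P_K^δ(x)` converges to the projection `P_K(x)`
as `δ → 0⁺` (Corollary 2, coordinate maps). -/
theorem laplace_projection_vector {d : ℕ}
    (K : Set (EuclideanSpace ℝ (Fin d))) (hKclosed : IsClosed K)
    (x yx : EuclideanSpace ℝ (Fin d))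
    (hyxK : yx ∈ K)
    (hproj : ∀ y ∈ K, y ≠ yx → ‖x - yx‖ ^ 2 < ‖x - y‖ ^ 2)
    (r₀ : ℝ) (hr₀ : 0 < r₀)
    (hvol : 0 < volume (K ∩ Metric.closedBall yx r₀))
    (hstar : ∀ y ∈ K ∩ Metric.closedBall yx r₀, ∀ α ∈ Set.Icc (0:ℝ) 1,
      α • y + (1 - α) • yx ∈ K)
    (hint : IntegrableOn (fun y : EuclideanSpace ℝ (Fin d) =>
      ‖(EuclideanSpace.equiv (Fin d) ℝ) y‖ *
        Real.exp (-(d : ℝ) * ‖x - y‖ ^ 2 / 2)) K) :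
    Tendsto (fun δ : ℝ =>
      (EuclideanSpace.equiv (Fin d) ℝ).symm (fun i =>
        (∫ y in K, y i * Real.exp (-‖x - y‖ ^ 2 / (2 * δ))) /
          (∫ y in K, Real.exp (-‖x - y‖ ^ 2 / (2 * δ)))))
      (𝓝[>] 0) (𝓝 yx) := by
  rcases Nat.eq_zero_or_pos d with rfl | hd
  · exact tendsto_const_nhds.congr fun _ => Subsingleton.elim _ _
  have hlim : ∀ g : EuclideanSpace ℝ (Fin d) → ℝ, Continuous g →
      IntegrableOn (fun y => g y * Real.exp (-(d * (‖x - y‖ ^ 2 / 2)))) K → Tendsto (fun c : ℝ =>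
        ∫ y in K, Real.exp (-(c * (‖x - y‖ ^ 2 / 2))) /
          (∫ z in K ∩ closedBall yx 1, Real.exp (-(c * (‖x - z‖ ^ 2 / 2)))) *
          (g y * Real.exp (-(d * (‖x - y‖ ^ 2 / 2)))))
        atTop (𝓝 (g yx * Real.exp (-(d * (‖x - yx‖ ^ 2 / 2))))) := fun g hg hgK =>
    tendsto_setIntegral_exp_neg_mul_div_of_unique_minimum hKclosed
      (fun r hr => measure_inter_closedBall_pos_of_star volume hr₀ hvol hstar hr) (by fun_prop)
      (fun u hu hpu => exists_lt_half_sq_norm_sub_of_unique_projection hKclosed hproj hu hpu)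
      hgK (by fun_prop)
  have hgauss : IntegrableOn
      (fun y => 1 * Real.exp (-((d : ℝ) * (‖x - y‖ ^ 2 / 2)))) K := by
    convert (integrable_exp_neg_mul_sq_norm_sub (b := (d : ℝ) / 2) (by positivity)
      x).integrableOn using 3 with y
    ring_nf
  have hcoord : ∀ i : Fin d, IntegrableOn
      (fun y => y i * Real.exp (-((d : ℝ) * (‖x - y‖ ^ 2 / 2)))) K := fun i => by
    refine Integrable.mono hint (by fun_prop) (ae_of_all _ fun y => ?_)
    rw [norm_mul, norm_mul, norm_norm]
    refine mul_le_mul (norm_le_pi_norm (EuclideanSpace.equiv (Fin d) ℝ y) i) (le_of_eq ?_)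
      (norm_nonneg _) (norm_nonneg _)
    ring_nf
  have hscale : Tendsto (fun δ : ℝ => δ⁻¹ - d) (𝓝[>] 0) atTop :=
    tendsto_atTop_add_const_right _ _ tendsto_inv_nhdsGT_zero
  refine (EuclideanSpace.equiv (Fin d) ℝ).symm.continuous.tendsto
    (EuclideanSpace.equiv (Fin d) ℝ yx) |>.comp (tendsto_pi_nhds.2 fun i => ?_)
  have hratio := ((hlim (fun y => y i) (by fun_prop) (hcoord i)).div
    (hlim (fun _ => 1) continuous_const hgauss) (by positivity)).comp hscale
  rw [mul_div_mul_right _ _ (Real.exp_pos _).ne', div_one] at hratio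
  refine hratio.congr' ?_
  have hne := ((hlim (fun _ => 1) continuous_const hgauss).comp hscale).eventually_ne
    (mul_pos one_pos (Real.exp_pos _)).ne'
  filter_upwards [hne] with δ hδ
  simp only [Function.comp_apply, Pi.div_apply] at hδ ⊢
  set Z := ∫ z in K ∩ closedBall yx 1, Real.exp (-((δ⁻¹ - d) * (‖x - z‖ ^ 2 / 2)))
  have hZ : Z ≠ 0 := fun hZ => hδ (by simp [hZ])
  have hweight : ∀ (a : ℝ) (y : EuclideanSpace ℝ (Fin d)),
      Real.exp (-((δ⁻¹ - d) * (‖x - y‖ ^ 2 / 2))) / Z *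
        (a * Real.exp (-(d * (‖x - y‖ ^ 2 / 2)))) =
      Z⁻¹ * (a * Real.exp (-‖x - y‖ ^ 2 / (2 * δ))) := fun a y => by
    have : -‖x - y‖ ^ 2 / (2 * δ) =
        -((δ⁻¹ - d) * (‖x - y‖ ^ 2 / 2)) + -(d * (‖x - y‖ ^ 2 / 2)) := by
      rw [div_eq_mul_inv, mul_inv]
      ring
    rw [this, Real.exp_add]
    ring
  simp only [hweight, integral_const_mul]
  simp only [one_mul]
  exact mul_div_mul_left _ _ (inv_ne_zero hZ)
end

section
/- Let A ⊆ ℝ^d be a measurable set, h : A → ℝ a measurable function, ψ : A → ℝ a measurable function, and suppose there exist constants ε₀ > 0 and q > 0 such that ψ(x) ≥ ε₀ for all x ∈ A and ∫_A |h(x)| exp(−d·ψ(x)/(q·ε₀)) dx < ∞. Then δ^{−d/q} ∫_A |h(x)| exp(−ψ(x)/δ) dx → 0 as δ → 0⁺. -/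
open MeasureTheory Real Filter Set Topology Metric

/-- If `ψ ≥ ε₀ > 0` on `A` and `|h| exp(-dψ/(qε₀))` is integrable on `A`, then
`δ^{-d/q} ∫_A |h| exp(-ψ/δ) → 0` as `δ → 0⁺`. -/
theorem tail_integral_vanishes {d : ℕ}
    (A : Set (EuclideanSpace ℝ (Fin d))) (hA : MeasurableSet A)
    (h ψ : EuclideanSpace ℝ (Fin d) → ℝ)
    (hh : Measurable h) (hψ : Measurable ψ)
    (ε₀ q : ℝ) (hε₀ : 0 < ε₀) (hq : 0 < q)
    (hlb : ∀ x ∈ A, ε₀ ≤ ψ x)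
    (hint : IntegrableOn
      (fun x => |h x| * Real.exp (-(d : ℝ) * ψ x / (q * ε₀))) A) :
    Tendsto (fun δ : ℝ =>
      δ ^ (-(d : ℝ) / q) * ∫ x in A, |h x| * Real.exp (-ψ x / δ))
      (𝓝[>] 0) (𝓝 0) := by
  set c : ℝ := d / (q * ε₀) with hc
  set I : ℝ := ∫ x in A, |h x| * Real.exp (-(d : ℝ) * ψ x / (q * ε₀)) with hI
  have hlim : Tendsto (fun δ : ℝ =>
      (δ⁻¹ ^ ((d : ℝ) / q) * Real.exp (-ε₀ * δ⁻¹)) * (Real.exp (c * ε₀) * I)) (𝓝[>] 0) (𝓝 0) := by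
    simpa using ((tendsto_rpow_mul_exp_neg_mul_atTop_nhds_zero ((d : ℝ) / q) ε₀ hε₀).comp
      tendsto_inv_nhdsGT_zero).mul_const (Real.exp (c * ε₀) * I)
  have hlarge : ∀ᶠ δ : ℝ in 𝓝[>] 0, c ≤ δ⁻¹ :=
    tendsto_inv_nhdsGT_zero.eventually (eventually_ge_atTop c)
  refine squeeze_zero' ?_ ?_ hlim
  · filter_upwards [self_mem_nhdsWithin] with δ hδ
    have hδ : 0 < δ := hδ
    have : 0 ≤ ∫ x in A, |h x| * Real.exp (-ψ x / δ) :=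
      integral_nonneg fun x => by positivity
    positivity
  · filter_upwards [self_mem_nhdsWithin, hlarge] with δ hδ hcδ
    have hδ : 0 < δ := hδ
    have hbound : ∫ x in A, |h x| * Real.exp (-ψ x / δ) ≤
        Real.exp (-ε₀ * δ⁻¹) * Real.exp (c * ε₀) * I := by
      rw [hI, ← integral_const_mul]
      refine integral_mono_of_nonneg (ae_of_all _ fun x => by positivity)
        (hint.const_mul _) ((ae_restrict_iff' hA).2 (ae_of_all _ fun x hx => ?_))
      have hexp : Real.exp (-ψ x / δ) ≤ Real.exp (-ε₀ * δ⁻¹) * Real.exp (c * ε₀) *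
          Real.exp (-(d : ℝ) * ψ x / (q * ε₀)) := by
        rw [← Real.exp_add, ← Real.exp_add, Real.exp_le_exp]
        have hψc : -(d : ℝ) * ψ x / (q * ε₀) = -(c * ψ x) := by rw [hc]; ring
        rw [hψc, div_eq_mul_inv]
        nlinarith [mul_nonneg (sub_nonneg.2 hcδ) (sub_nonneg.2 (hlb x hx))]
      calc |h x| * Real.exp (-ψ x / δ) ≤ |h x| * _ :=
            mul_le_mul_of_nonneg_left hexp (abs_nonneg _)
        _ = _ := by ring
    have hpow : δ ^ (-(d : ℝ) / q) = δ⁻¹ ^ ((d : ℝ) / q) := by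
      rw [neg_div, Real.rpow_neg hδ.le, Real.inv_rpow hδ.le]
    rw [hpow]
    calc _ ≤ δ⁻¹ ^ ((d : ℝ) / q) * (Real.exp (-ε₀ * δ⁻¹) * Real.exp (c * ε₀) * I) := by gcongr
      _ = _ := by ring
end
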